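/- Let n ≥ 1 and Q = 2n+2. There exist ν₀ ∈ ℕ and c > 0 such that for every k ∈ ℕ with ν = 4k+2n ≥ ν₀ and every λ > 0: (i) if 0 < λ ≤ ν then ∫₀¹ |χ̂_{B_ρ}(λ,k)|² dρ ≥ c·⟨λν⟩^{−Q/2+1/2}·⟨λ⟩^{−2}; (ii) if ν < λ ≤ 2(ν+ν^{1/3}) then ∫₀¹ |χ̂_{B_ρ}(λ,k)|² dρ ≥ c·λ^{−Q−2/3}·⟨ν^{2/3}(1−λ/(2ν))⟩^{−1/2}; (iii) if λ > 2(ν+ν^{1/3}) then ∫₀¹ |χ̂_{B_ρ}(λ,k)|² dρ ≥ c·λ^{−Q−1}·(λ−2ν). -/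

import Mathlib

open MeasureTheory Complex

noncomputable section

/-- The generalized Laguerre polynomials
`L_k^δ(t) = t^{−δ} e^t (1/k!) (d/dt)^k (e^{−t} t^{k+δ})`. -/
def genLaguerre (k : ℕ) (δ : ℝ) (t : ℝ) : ℝ :=
  t ^ (-δ) * Real.exp t * ((k.factorial : ℝ))⁻¹ *
    iteratedDeriv k (fun s => Real.exp (-s) * s ^ ((k : ℝ) + δ)) t

/-- The normalizing constant `r_k = (k!/(n+k−1)!)^{1/2}`. -/
def rk (n k : ℕ) : ℝ := Real.sqrt ((k.factorial : ℝ) / ((n + k - 1).factorial : ℝ))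

/-- The Laguerre functions `Λ_k^{n−1}(t) = r_k L_k^{n−1}(t) e^{−t/2} t^{(n−1)/2}`. -/
def lagFun (n k : ℕ) (t : ℝ) : ℝ :=
  rk n k * genLaguerre k ((n : ℝ) - 1) t * Real.exp (-t / 2) * t ^ (((n : ℝ) - 1) / 2)

/-- The radial Fourier coefficient
`f̂(λ,k) = r_k ∫₀^∞ f_#^λ(r) (|λ|r²)^{(1−n)/2} Λ_k^{n−1}(|λ|r²/2) r^{2n−1} dr`,
where `f_#^λ(r) = ∫_ℝ f_#(r,t) e^{iλt} dt`. -/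
def radialCoeff (n : ℕ) (fsharp : ℝ → ℝ → ℂ) (lam : ℝ) (k : ℕ) : ℂ :=
  (rk n k : ℂ) * ∫ r in Set.Ioi (0 : ℝ),
    (∫ t : ℝ, fsharp r t * Complex.exp (Complex.I * (lam : ℂ) * (t : ℂ))) *
      (((|lam| * r ^ 2) ^ ((1 - (n : ℝ)) / 2) : ℝ) : ℂ) *
      ((lagFun n k (|lam| * r ^ 2 / 2) : ℝ) : ℂ) *
      ((r ^ (2 * (n : ℝ) - 1) : ℝ) : ℂ)

/-- `ν = 4k + 2n`. -/
def nuv (n k : ℕ) : ℕ := 4 * k + 2 * n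

/-- The radial Fourier coefficient of the indicator of `B = {(z,t) : |z| ≤ 1, |t| ≤ 1}`:
`χ̂_B(λ,k) = r_k (sin λ/λ^{n+1}) (2ν)^{(n+1)/2} ∫₀^{λ/(2ν)} Λ_k^{n−1}(νt) t^{(n−1)/2} dt`. -/
def chiHatB (n k : ℕ) (lam : ℝ) : ℝ :=
  rk n k * (Real.sin lam / lam ^ (n + 1)) *
    (2 * (nuv n k : ℝ)) ^ (((n : ℝ) + 1) / 2) *
    ∫ t in (0 : ℝ)..(lam / (2 * (nuv n k : ℝ))),
      lagFun n k ((nuv n k : ℝ) * t) * t ^ (((n : ℝ) - 1) / 2)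

/-- The Japanese bracket `⟨x⟩ = (1+x²)^{1/2}`. -/
def jap (x : ℝ) : ℝ := Real.sqrt (1 + x ^ 2)

/-- The squared average over dilations:
`∫₀¹ |χ̂_{B_ρ}(λ,k)|² dρ` where `χ̂_{B_ρ}(λ,k) = ρ^{2n+2} χ̂_B(ρ²λ,k)`. -/
def avgSq (n k : ℕ) (lam : ℝ) : ℝ :=
  ∫ ρ in (0 : ℝ)..1, (ρ ^ (2 * n + 2) * chiHatB n k (ρ ^ 2 * lam)) ^ 2

/-- The coefficients of the Laguerre polynomial `L_k^a` for a natural number `a`. -/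
def lagCoeff (a k j : ℕ) : ℝ :=
  (-1) ^ j * (k.choose j : ℝ) * ((k + a).factorial : ℝ) / ((k.factorial : ℝ) * ((a + j).factorial : ℝ))

/-- The Laguerre polynomial `L_k^a` for a natural number `a`. -/
def lagPoly (a k : ℕ) : Polynomial ℝ :=
  ∑ j ∈ Finset.range (k + 1), Polynomial.monomial j (lagCoeff a k j)

lemma lagCoeff_eq_zero {a k j : ℕ} (h : k < j) : lagCoeff a k j = 0 := by
  simp [lagCoeff, Nat.choose_eq_zero_of_lt h]

lemma coeff_lagPoly (a k j : ℕ) : (lagPoly a k).coeff j = lagCoeff a k j := by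
  rw [lagPoly, Polynomial.finsetSum_coeff]
  simp only [Polynomial.coeff_monomial]
  by_cases h : k < j
  · rw [lagCoeff_eq_zero h]
    refine Finset.sum_eq_zero fun i hi => ?_
    rw [Finset.mem_range] at hi
    rw [if_neg (by omega)]
  · simp [Finset.sum_ite_eq', Finset.mem_range]
    intro h'; omega

lemma eval_lagPoly (a k : ℕ) (t : ℝ) :
    (lagPoly a k).eval t = ∑ j ∈ Finset.range (k + 1), lagCoeff a k j * t ^ j := by
  simp [lagPoly, Polynomial.eval_finsetSum]

lemma lagCoeff_succ (a k j : ℕ) :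
    ((j : ℝ) + 1) * (j + 1 + a) * lagCoeff a k (j + 1) = -((k : ℝ) - j) * lagCoeff a k j := by
  have hc : (k.choose (j + 1) : ℝ) * (j + 1) = k.choose j * ((k : ℝ) - j) := by
    rcases le_or_gt j k with h | h
    · have := Nat.choose_succ_right_eq k j
      rw [← Nat.cast_sub h]
      exact_mod_cast this
    · simp [Nat.choose_eq_zero_of_lt h, Nat.choose_eq_zero_of_lt (h.trans (Nat.lt_succ_self j))]
  have hf : ((a + (j + 1)).factorial : ℝ) = (a + j + 1) * ((a + j).factorial : ℝ) := by
    rw [← add_assoc, Nat.factorial_succ]; push_cast; ring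
  have h1 : ((a + j).factorial : ℝ) ≠ 0 := by positivity
  have h2 : (k.factorial : ℝ) ≠ 0 := by positivity
  have h3 : (a + j + 1 : ℝ) ≠ 0 := by positivity
  unfold lagCoeff
  rw [hf, pow_succ]
  field_simp
  linear_combination (-(j + 1 + a : ℝ)) * hc

open Polynomial in
/-- The Laguerre differential equation. -/
lemma lagPoly_ode (a k : ℕ) :
    X * derivative (derivative (lagPoly a k)) + (C ((a : ℝ) + 1) - X) * derivative (lagPoly a k)
      + C (k : ℝ) * lagPoly a k = 0 := by
  ext j
  rw [sub_mul, coeff_add, coeff_add, coeff_sub, coeff_C_mul, coeff_C_mul, coeff_zero]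
  rcases j with _ | j
  · have := lagCoeff_succ a k 0
    simp [coeff_derivative, coeff_lagPoly] at this ⊢
    linear_combination this
  · have := lagCoeff_succ a k (j + 1)
    simp only [coeff_X_mul, coeff_derivative, coeff_lagPoly]
    push_cast at this ⊢
    linear_combination this

lemma genLaguerre_eq (a k : ℕ) {t : ℝ} (ht : 0 < t) :
    genLaguerre k (((a + 1 : ℕ) : ℝ) - 1) t = (lagPoly a k).eval t := by
  have hfun : (fun s : ℝ => Real.exp (-s) * s ^ ((k : ℝ) + (((a + 1 : ℕ) : ℝ) - 1))) =
      fun s : ℝ => Real.exp ((-1) * s) * s ^ (k + a) := by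
    funext s
    have : (k : ℝ) + (((a + 1 : ℕ) : ℝ) - 1) = ((k + a : ℕ) : ℝ) := by push_cast; ring
    rw [this, Real.rpow_natCast, neg_one_mul]
  have hpow : t ^ (-(((a + 1 : ℕ) : ℝ) - 1)) = (t ^ a)⁻¹ := by
    have : (-(((a + 1 : ℕ) : ℝ) - 1)) = -(a : ℝ) := by push_cast; ring
    rw [this, Real.rpow_neg ht.le, Real.rpow_natCast]
  rw [genLaguerre, hfun, hpow, iteratedDeriv_fun_mul (by fun_prop) (by fun_prop), eval_lagPoly,
    Finset.mul_sum]
  refine Finset.sum_congr rfl fun i hi => ?_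
  have hik : i ≤ k := by rw [Finset.mem_range] at hi; omega
  rw [iteratedDeriv_exp_const_mul, iteratedDeriv_pow]
  have e1 : k + a - (k - i) = a + i := by omega
  have e2 : ((k + a).descFactorial (k - i) : ℝ) = (k + a).factorial / (a + i).factorial := by
    rw [eq_div_iff (by positivity), ← e1, mul_comm]
    exact_mod_cast Nat.factorial_mul_descFactorial (by omega : k - i ≤ k + a)
  rw [e1, e2, lagCoeff, pow_add]
  have h1 : ((a + i).factorial : ℝ) ≠ 0 := by positivity
  have h2 : (k.factorial : ℝ) ≠ 0 := by positivity
  have h3 : t ^ a ≠ 0 := by positivity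
  field_simp
  have h0' : Real.exp t * Real.exp (-t) = 1 := by rw [← Real.exp_add]; simp
  linear_combination (k.choose i : ℝ) * h0'

/-- The exponentially damped Laguerre polynomial `e^{-s/2} L_k^a(s)`. -/
def lagPhi (a k : ℕ) (s : ℝ) : ℝ := Real.exp (-s / 2) * (lagPoly a k).eval s

/-- The derivative of `lagPhi`. -/
def lagPhi₁ (a k : ℕ) (s : ℝ) : ℝ :=
  Real.exp (-s / 2) *
    ((Polynomial.derivative (lagPoly a k)).eval s - (lagPoly a k).eval s / 2)

/-- The second derivative of `lagPhi`. -/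
def lagPhi₂ (a k : ℕ) (s : ℝ) : ℝ :=
  Real.exp (-s / 2) *
    ((Polynomial.derivative (Polynomial.derivative (lagPoly a k))).eval s
      - (Polynomial.derivative (lagPoly a k)).eval s + (lagPoly a k).eval s / 4)

/-- `ν = 4k + 2n` as a real number, for `n = a + 1`. -/
def nuR (a k : ℕ) : ℝ := 4 * k + 2 * (a + 1)

lemma hasDerivAt_exp_neg_half (s : ℝ) :
    HasDerivAt (fun s : ℝ => Real.exp (-s / 2)) (-(1 / 2) * Real.exp (-s / 2)) s := by
  have : HasDerivAt (fun s : ℝ => -s / 2) (-1 / 2) s := (hasDerivAt_id s).neg.div_const 2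
  exact this.exp.congr_deriv (by ring)

lemma hasDerivAt_lagPhi (a k : ℕ) (s : ℝ) : HasDerivAt (lagPhi a k) (lagPhi₁ a k s) s :=
  ((hasDerivAt_exp_neg_half s).mul ((lagPoly a k).hasDerivAt s)).congr_deriv
    (by rw [lagPhi₁]; ring)

lemma hasDerivAt_lagPhi₁ (a k : ℕ) (s : ℝ) : HasDerivAt (lagPhi₁ a k) (lagPhi₂ a k s) s :=
  ((hasDerivAt_exp_neg_half s).mul
    (((Polynomial.derivative (lagPoly a k)).hasDerivAt s).sub
      (((lagPoly a k).hasDerivAt s).div_const 2))).congr_deriv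
    (by rw [lagPhi₂]; simp only [Pi.sub_apply]; ring)

lemma lagPhi_ode (a k : ℕ) (s : ℝ) :
    s * lagPhi₂ a k s + (a + 1) * lagPhi₁ a k s + (nuR a k - s) / 4 * lagPhi a k s = 0 := by
  have h := congrArg (Polynomial.eval s) (lagPoly_ode a k)
  simp only [Polynomial.eval_add, Polynomial.eval_mul, Polynomial.eval_sub, Polynomial.eval_X,
    Polynomial.eval_C, Polynomial.eval_zero] at h
  rw [lagPhi₂, lagPhi₁, lagPhi, nuR]
  linear_combination Real.exp (-s / 2) * h

lemma continuous_lagPhi (a k : ℕ) : Continuous (lagPhi a k) :=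
  continuous_iff_continuousAt.2 fun s => (hasDerivAt_lagPhi a k s).continuousAt

/-- `(k+a)!/k!`, which is the value of `r_k^{-2}` for `n = a + 1`. -/
def lagR (a k : ℕ) : ℝ := ((k + a).factorial : ℝ) / k.factorial

lemma lagR_pos (a k : ℕ) : 0 < lagR a k := by unfold lagR; positivity

lemma lagPhi_zero (a k : ℕ) : lagPhi a k 0 = lagR a k / a.factorial := by
  rw [lagPhi, ← Polynomial.coeff_zero_eq_eval_zero, coeff_lagPoly, lagCoeff, lagR]
  simp
  field_simp

/-- The primitive of `s^a e^{-s/2} L_k^a(s)`. -/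
def lagG (a k : ℕ) (x : ℝ) : ℝ := ∫ s in (0 : ℝ)..x, s ^ a * lagPhi a k s

lemma hasDerivAt_lagG (a k : ℕ) (x : ℝ) : HasDerivAt (lagG a k) (x ^ a * lagPhi a k x) x := by
  have hc : Continuous fun s : ℝ => s ^ a * lagPhi a k s :=
    (continuous_pow a).mul (continuous_lagPhi a k)
  exact intervalIntegral.integral_hasDerivAt_right (hc.intervalIntegrable _ _)
    (hc.stronglyMeasurableAtFilter _ _) hc.continuousAt

lemma continuous_lagG (a k : ℕ) : Continuous (lagG a k) :=
  continuous_iff_continuousAt.2 fun s => (hasDerivAt_lagG a k s).continuousAt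

lemma tendsto_integral_pow_mul_exp (m : ℕ) :
    Filter.Tendsto (fun x : ℝ => ∫ s in (0 : ℝ)..x, s ^ m * Real.exp (-s / 2)) Filter.atTop
      (nhds ((m.factorial : ℝ) * 2 ^ (m + 1))) := by
  have hval := Real.integral_rpow_mul_exp_neg_mul_Ioi (a := (m : ℝ) + 1) (r := 1 / 2)
    (by positivity) (by norm_num)
  have hfun : (fun t : ℝ => t ^ ((m : ℝ) + 1 - 1) * Real.exp (-(1 / 2 * t))) =
      fun t : ℝ => t ^ m * Real.exp (-t / 2) := by
    funext t
    rw [add_sub_cancel_right, Real.rpow_natCast]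
    congr 2; ring
  have hrhs : (1 / (1 / 2) : ℝ) ^ ((m : ℝ) + 1) * Real.Gamma ((m : ℝ) + 1) =
      (m.factorial : ℝ) * 2 ^ (m + 1) := by
    rw [Real.Gamma_nat_eq_factorial, one_div_one_div, mul_comm]
    congr 1
    exact_mod_cast Real.rpow_natCast 2 (m + 1)
  rw [hfun, hrhs] at hval
  rw [← hval]
  refine intervalIntegral_tendsto_integral_Ioi 0 ?_ Filter.tendsto_id
  by_contra h
  rw [integral_undef h] at hval
  have : (0 : ℝ) < (m.factorial : ℝ) * 2 ^ (m + 1) := by positivity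
  linarith

lemma tendsto_lagG (a k : ℕ) :
    Filter.Tendsto (lagG a k) Filter.atTop (nhds ((-1) ^ k * 2 ^ (a + 1) * lagR a k)) := by
  have hG : lagG a k = fun x => ∑ j ∈ Finset.range (k + 1),
      lagCoeff a k j * ∫ s in (0 : ℝ)..x, s ^ (a + j) * Real.exp (-s / 2) := by
    funext x
    simp_rw [lagG, lagPhi, eval_lagPoly, ← intervalIntegral.integral_const_mul]
    rw [← intervalIntegral.integral_finsetSum]
    · refine intervalIntegral.integral_congr fun s _ => ?_
      simp only [Finset.mul_sum]
      refine Finset.sum_congr rfl fun j _ => ?_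
      rw [pow_add]; ring
    · intro j _
      exact Continuous.intervalIntegrable (by fun_prop) _ _
  have hlim : (∑ j ∈ Finset.range (k + 1),
      lagCoeff a k j * (((a + j).factorial : ℝ) * 2 ^ (a + j + 1))) =
      (-1) ^ k * 2 ^ (a + 1) * lagR a k := by
    have hb : ∑ j ∈ Finset.range (k + 1), (-2 : ℝ) ^ j * (k.choose j : ℝ) = (-1) ^ k := by
      have := add_pow (-2 : ℝ) 1 k
      simp only [one_pow, mul_one] at this
      rw [← this]; norm_num
    rw [← hb, Finset.sum_mul, Finset.sum_mul]
    refine Finset.sum_congr rfl fun j _ => ?_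
    have h1 : ((a + j).factorial : ℝ) ≠ 0 := by positivity
    have h2 : (k.factorial : ℝ) ≠ 0 := by positivity
    have h3 : (-2 : ℝ) ^ j = (-1) ^ j * 2 ^ j := by rw [← mul_pow]; norm_num
    rw [lagCoeff, lagR, h3]
    field_simp
    ring
  rw [hG, ← hlim]
  exact tendsto_finsetSum _ fun j _ => (tendsto_integral_pow_mul_exp (a + j)).const_mul _

lemma nuR_eq (a k : ℕ) : ((nuv (a + 1) k : ℕ) : ℝ) = nuR a k := by
  rw [nuv, nuR]; push_cast; ring

lemma nuR_pos (a k : ℕ) : 0 < nuR a k := by unfold nuR; positivity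

lemma rk_sq (a k : ℕ) : rk (a + 1) k ^ 2 = (lagR a k)⁻¹ := by
  have h : a + 1 + k - 1 = k + a := by omega
  rw [rk, Real.sq_sqrt (by positivity), h, lagR, inv_div]

lemma chiHatB_eq (a k : ℕ) {u : ℝ} (hu : 0 < u) :
    chiHatB (a + 1) k u =
      (lagR a k)⁻¹ * (Real.sin u / u ^ (a + 2)) * (2 : ℝ) ^ (((a : ℝ) + 2) / 2) *
        lagG a k (u / 2) := by
  have hN := nuR_pos a k
  have hint : ∫ t in (0 : ℝ)..(u / (2 * nuR a k)),
      lagFun (a + 1) k (nuR a k * t) * t ^ ((((a + 1 : ℕ) : ℝ) - 1) / 2) =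
      rk (a + 1) k * nuR a k ^ (-((a : ℝ) / 2)) * ((nuR a k)⁻¹ * lagG a k (u / 2)) := by
    have hG : (nuR a k)⁻¹ * lagG a k (u / 2) = ∫ t in (0 : ℝ)..(u / (2 * nuR a k)),
        (fun s => s ^ a * lagPhi a k s) (nuR a k * t) := by
      rw [intervalIntegral.integral_comp_mul_left (fun s => s ^ a * lagPhi a k s) hN.ne', lagG,
        smul_eq_mul, mul_zero]
      congr 3
      field_simp
    rw [hG, ← intervalIntegral.integral_const_mul]
    refine intervalIntegral.integral_congr_ae (Filter.Eventually.of_forall fun t ht => ?_)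
    rw [Set.uIoc_of_le (by positivity)] at ht
    have ht0 := ht.1
    have hNt : 0 < nuR a k * t := by positivity
    have e : (((a + 1 : ℕ) : ℝ) - 1) / 2 = (a : ℝ) / 2 := by push_cast; ring
    rw [lagFun, genLaguerre_eq a k hNt, e]
    have hp : (nuR a k * t) ^ ((a : ℝ) / 2) * t ^ ((a : ℝ) / 2) =
        nuR a k ^ (-((a : ℝ) / 2)) * (nuR a k * t) ^ a := by
      rw [← Real.rpow_natCast (nuR a k * t) a, Real.mul_rpow hN.le ht0.le,
        Real.mul_rpow hN.le ht0.le, ← mul_assoc (nuR a k ^ (-((a : ℝ) / 2))),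
        ← Real.rpow_add hN, mul_assoc, ← Real.rpow_add ht0]
      congr 2 <;> ring
    simp only [lagPhi]
    linear_combination (rk (a + 1) k * (lagPoly a k).eval (nuR a k * t) *
      Real.exp (-(nuR a k * t) / 2)) * hp
  have hN2 : (2 * nuR a k) ^ ((((a + 1 : ℕ) : ℝ) + 1) / 2) =
      2 ^ (((a : ℝ) + 2) / 2) * (nuR a k ^ ((a : ℝ) / 2) * nuR a k) := by
    have e : (((a + 1 : ℕ) : ℝ) + 1) / 2 = ((a : ℝ) + 2) / 2 := by push_cast; ring
    rw [e, Real.mul_rpow (by norm_num) hN.le]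
    congr 1
    have e2 : ((a : ℝ) + 2) / 2 = (a : ℝ) / 2 + 1 := by ring
    rw [e2, Real.rpow_add_one hN.ne']
  have hinv : nuR a k ^ ((a : ℝ) / 2) * nuR a k ^ (-((a : ℝ) / 2)) = 1 := by
    rw [← Real.rpow_add hN]; simp
  rw [chiHatB, nuR_eq, hint, hN2, ← rk_sq]
  have h1 : nuR a k * (nuR a k)⁻¹ = 1 := mul_inv_cancel₀ hN.ne'
  calc _ = rk (a + 1) k ^ 2 * (Real.sin u / u ^ (a + 2)) * (2 : ℝ) ^ (((a : ℝ) + 2) / 2) *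
        lagG a k (u / 2) * (nuR a k ^ ((a : ℝ) / 2) * nuR a k ^ (-((a : ℝ) / 2))) *
        (nuR a k * (nuR a k)⁻¹) := by ring
    _ = _ := by rw [hinv, h1]; ring

/-- The weighted mean square of the primitive `lagG`, in the quadratic variable. -/
def lagF (a k : ℕ) (X : ℝ) : ℝ :=
  ∫ x in (0 : ℝ)..X, Real.sin (2 * x ^ 2) ^ 2 * lagG a k (x ^ 2) ^ 2

lemma continuous_lagF_integrand (a k : ℕ) :
    Continuous fun x : ℝ => Real.sin (2 * x ^ 2) ^ 2 * lagG a k (x ^ 2) ^ 2 := by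
  have := continuous_lagG a k
  fun_prop

lemma integral_le_lagF (a k : ℕ) {x y X : ℝ} (hx : 0 ≤ x) (hxy : x ≤ y) (hy : y ≤ X) :
    ∫ t in x..y, Real.sin (2 * t ^ 2) ^ 2 * lagG a k (t ^ 2) ^ 2 ≤ lagF a k X :=
  intervalIntegral.integral_mono_interval hx hxy hy
    (Filter.Eventually.of_forall fun t => by positivity)
    ((continuous_lagF_integrand a k).intervalIntegrable _ _)

lemma lagF_mono (a k : ℕ) {x X : ℝ} (hx : 0 ≤ x) (h : x ≤ X) : lagF a k x ≤ lagF a k X :=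
  integral_le_lagF a k le_rfl hx h

lemma lagF_nonneg (a k : ℕ) {x : ℝ} (hx : 0 ≤ x) : 0 ≤ lagF a k x :=
  intervalIntegral.integral_nonneg hx fun t _ => by positivity

lemma avgSq_eq (a k : ℕ) {lam : ℝ} (hlam : 0 < lam) :
    avgSq (a + 1) k lam =
      2 ^ (a + 2) * (lagR a k ^ 2)⁻¹ * (lam ^ (2 * a + 4))⁻¹ * (Real.sqrt (lam / 2))⁻¹ *
        lagF a k (Real.sqrt (lam / 2)) := by
  have hX : 0 < Real.sqrt (lam / 2) := Real.sqrt_pos.2 (by positivity)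
  have hX2 : Real.sqrt (lam / 2) ^ 2 = lam / 2 := Real.sq_sqrt (by positivity)
  set X := Real.sqrt (lam / 2) with hXdef
  have hF : X⁻¹ * lagF a k X = ∫ ρ in (0 : ℝ)..1,
      (fun x => Real.sin (2 * x ^ 2) ^ 2 * lagG a k (x ^ 2) ^ 2) (X * ρ) := by
    rw [intervalIntegral.integral_comp_mul_left
      (fun x => Real.sin (2 * x ^ 2) ^ 2 * lagG a k (x ^ 2) ^ 2) hX.ne', lagF, smul_eq_mul,
      mul_zero, mul_one]
  rw [mul_assoc, hF, avgSq, ← intervalIntegral.integral_const_mul]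
  refine intervalIntegral.integral_congr_ae (Filter.Eventually.of_forall fun t ht => ?_)
  rw [Set.uIoc_of_le zero_le_one] at ht
  have ht0 := ht.1
  have e1 : 2 * (X * t) ^ 2 = t ^ 2 * lam := by rw [mul_pow, hX2]; ring
  have e2 : (X * t) ^ 2 = t ^ 2 * lam / 2 := by rw [mul_pow, hX2]; ring
  have e3 : ((2 : ℝ) ^ (((a : ℝ) + 2) / 2)) ^ 2 = 2 ^ (a + 2) := by
    rw [← Real.rpow_natCast, ← Real.rpow_mul (by norm_num), ← Real.rpow_natCast]
    congr 1; push_cast; ring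
  have hR := (lagR_pos a k).ne'
  rw [chiHatB_eq a k (by positivity)]
  simp only [e1]
  rw [e2, ← e3]
  field_simp
  ring

/-- The adiabatic energy of a solution `h` (with derivative `h₁`) of
`h'' = -(N - x² - β/x²) h`. -/
def oscEnergy (N : ℝ) (h h₁ : ℝ → ℝ) (x : ℝ) : ℝ :=
  h₁ x ^ 2 / Real.sqrt (N - x ^ 2) + Real.sqrt (N - x ^ 2) * h x ^ 2

/-- The energy with its first adiabatic correction. -/
def oscEnergyCorr (N : ℝ) (h h₁ : ℝ → ℝ) (x : ℝ) : ℝ :=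
  oscEnergy N h h₁ x - x / Real.sqrt (N - x ^ 2) ^ 3 * (h x * h₁ x)

/-- The logarithmic growth bound of the corrected energy. -/
def oscRate (N β x : ℝ) : ℝ :=
  x / Real.sqrt (N - x ^ 2) ^ 3 - 4 * |β| / N * (Real.sqrt (N - x ^ 2) / x)

lemma oscEnergy_nonneg (N : ℝ) (h h₁ : ℝ → ℝ) (x : ℝ) : 0 ≤ oscEnergy N h h₁ x := by
  unfold oscEnergy; positivity

lemma abs_mul_le_oscEnergy {N : ℝ} (h h₁ : ℝ → ℝ) {x : ℝ} (hx : x ^ 2 < N) :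
    |h x * h₁ x| ≤ oscEnergy N h h₁ x / 2 := by
  have hr : 0 < Real.sqrt (N - x ^ 2) := Real.sqrt_pos.2 (by linarith)
  rw [oscEnergy]
  set r := Real.sqrt (N - x ^ 2)
  have key : h₁ x ^ 2 / r + r * h x ^ 2 = (h₁ x ^ 2 + (r * h x) ^ 2) / r := by
    field_simp
  have e : h x * h₁ x = (r * h x) * h₁ x / r := by field_simp
  rw [key, e, abs_div, abs_of_pos hr, div_div, mul_comm r 2, ← div_div]
  refine div_le_div_of_nonneg_right ?_ hr.le
  rw [abs_le]
  constructor <;> nlinarith [sq_nonneg (r * h x + h₁ x), sq_nonneg (r * h x - h₁ x)]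

lemma oscEnergyCorr_bounds {N : ℝ} (h h₁ : ℝ → ℝ) {x : ℝ} (hx0 : 0 < x) (hx : x ^ 2 < N)
    (ha : x ≤ Real.sqrt (N - x ^ 2) ^ 3) :
    oscEnergy N h h₁ x / 2 ≤ oscEnergyCorr N h h₁ x ∧
      oscEnergyCorr N h h₁ x ≤ 3 / 2 * oscEnergy N h h₁ x := by
  have hr : 0 < Real.sqrt (N - x ^ 2) := Real.sqrt_pos.2 (by linarith)
  have h1 : x / Real.sqrt (N - x ^ 2) ^ 3 ≤ 1 := (div_le_one (by positivity)).2 ha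
  have h0 : 0 ≤ x / Real.sqrt (N - x ^ 2) ^ 3 := by positivity
  have h2 := abs_mul_le_oscEnergy h h₁ hx
  have h3 : |x / Real.sqrt (N - x ^ 2) ^ 3 * (h x * h₁ x)| ≤ oscEnergy N h h₁ x / 2 := by
    rw [abs_mul, abs_of_nonneg h0]
    calc _ ≤ 1 * |h x * h₁ x| := by gcongr
      _ ≤ _ := by rwa [one_mul]
  rw [abs_le] at h3
  rw [oscEnergyCorr]
  constructor <;> linarith [h3.1, h3.2]

lemma hasDerivAt_sqrt_sub_sq {N x : ℝ} (hx : x ^ 2 < N) :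
    HasDerivAt (fun x => Real.sqrt (N - x ^ 2)) (-x / Real.sqrt (N - x ^ 2)) x := by
  have h : HasDerivAt (fun x : ℝ => N - x ^ 2) (-(2 * x)) x := by
    simpa using (hasDerivAt_pow 2 x).const_sub N
  refine (h.sqrt (by linarith)).congr_deriv ?_
  have hr : 0 < Real.sqrt (N - x ^ 2) := Real.sqrt_pos.2 (by linarith)
  field_simp

lemma hasDerivAt_oscRate {N β x : ℝ} (hx0 : 0 < x) (hx : x ^ 2 < N) :
    HasDerivAt (oscRate N β)
      (1 / Real.sqrt (N - x ^ 2) ^ 3 + 3 * x ^ 2 / Real.sqrt (N - x ^ 2) ^ 5 +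
        4 * |β| / (x ^ 2 * Real.sqrt (N - x ^ 2))) x := by
  have hr : 0 < Real.sqrt (N - x ^ 2) := Real.sqrt_pos.2 (by linarith)
  have hN : 0 < N := by nlinarith
  have hd := hasDerivAt_sqrt_sub_sq hx
  refine (((hasDerivAt_id x).div (hd.pow 3) (pow_pos hr 3).ne').sub
    ((hd.div (hasDerivAt_id x) hx0.ne').const_mul (4 * |β| / N))).congr_deriv ?_
  have hr2 : N = Real.sqrt (N - x ^ 2) ^ 2 + x ^ 2 := by
    rw [Real.sq_sqrt (by linarith)]; ring
  simp only [id, Nat.cast_ofNat, Pi.pow_apply]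
  set r := Real.sqrt (N - x ^ 2)
  have hN' : r ^ 2 + x ^ 2 ≠ 0 := by positivity
  rw [hr2]
  field_simp
  ring

lemma hasDerivAt_oscEnergyCorr {N β : ℝ} {h h₁ : ℝ → ℝ} {x : ℝ} (hx : x ^ 2 < N)
    (hh : HasDerivAt h (h₁ x) x) (hh₁ : HasDerivAt h₁ (-(N - x ^ 2 - β / x ^ 2) * h x) x) :
    HasDerivAt (oscEnergyCorr N h h₁)
      (-(1 / Real.sqrt (N - x ^ 2) ^ 3 + 3 * x ^ 2 / Real.sqrt (N - x ^ 2) ^ 5) * (h x * h₁ x) +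
        β / x ^ 2 * (2 * (h x * h₁ x) / Real.sqrt (N - x ^ 2) -
          x / Real.sqrt (N - x ^ 2) ^ 3 * h x ^ 2)) x := by
  have hr : 0 < Real.sqrt (N - x ^ 2) := Real.sqrt_pos.2 (by linarith)
  have hd := hasDerivAt_sqrt_sub_sq hx
  refine ((((hh₁.pow 2).div hd hr.ne').add (hd.mul (hh.pow 2))).sub
    (((hasDerivAt_id x).div (hd.pow 3) (pow_pos hr 3).ne').mul (hh.mul hh₁))).congr_deriv ?_
  have hr2 : N - x ^ 2 - β / x ^ 2 = Real.sqrt (N - x ^ 2) ^ 2 - β / x ^ 2 := by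
    rw [Real.sq_sqrt (by linarith)]
  rw [hr2]
  simp only [id, Nat.cast_ofNat, Pi.pow_apply, Pi.mul_apply, Pi.div_apply]
  set r := Real.sqrt (N - x ^ 2)
  generalize β / x ^ 2 = B
  field_simp
  ring

lemma abs_deriv_oscEnergyCorr_le {N β : ℝ} {h h₁ : ℝ → ℝ} {x : ℝ} (hx0 : 0 < x) (hx : x ^ 2 < N)
    (ha : x ≤ Real.sqrt (N - x ^ 2) ^ 3) :
    |-(1 / Real.sqrt (N - x ^ 2) ^ 3 + 3 * x ^ 2 / Real.sqrt (N - x ^ 2) ^ 5) * (h x * h₁ x) +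
        β / x ^ 2 * (2 * (h x * h₁ x) / Real.sqrt (N - x ^ 2) -
          x / Real.sqrt (N - x ^ 2) ^ 3 * h x ^ 2)| ≤
      (1 / Real.sqrt (N - x ^ 2) ^ 3 + 3 * x ^ 2 / Real.sqrt (N - x ^ 2) ^ 5 +
        4 * |β| / (x ^ 2 * Real.sqrt (N - x ^ 2))) * oscEnergyCorr N h h₁ x := by
  have hr : 0 < Real.sqrt (N - x ^ 2) := Real.sqrt_pos.2 (by linarith)
  have hE := abs_mul_le_oscEnergy h h₁ hx
  have hW := (oscEnergyCorr_bounds h h₁ hx0 hx ha).1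
  have h1 : x / Real.sqrt (N - x ^ 2) ^ 3 ≤ 1 := (div_le_one (by positivity)).2 ha
  have hh2 : h x ^ 2 ≤ oscEnergy N h h₁ x / Real.sqrt (N - x ^ 2) := by
    rw [le_div_iff₀ hr, oscEnergy]
    have : 0 ≤ h₁ x ^ 2 / Real.sqrt (N - x ^ 2) := by positivity
    linarith
  set r := Real.sqrt (N - x ^ 2)
  set E := oscEnergy N h h₁ x
  set W := oscEnergyCorr N h h₁ x
  set A := 1 / r ^ 3 + 3 * x ^ 2 / r ^ 5 with hA
  have hA0 : 0 ≤ A := by positivity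
  have hp : |x / r ^ 3 * h x ^ 2| ≤ 2 * W / r := by
    rw [abs_of_nonneg (by positivity)]
    calc _ ≤ 1 * (E / r) := by gcongr
      _ ≤ _ := by rw [one_mul]; gcongr; linarith
  have hq : |2 * (h x * h₁ x) / r| ≤ 2 * W / r := by
    rw [abs_div, abs_of_pos hr, abs_mul, abs_two]
    gcongr
    linarith
  calc _ ≤ |-A * (h x * h₁ x)| + |β / x ^ 2 * (2 * (h x * h₁ x) / r - x / r ^ 3 * h x ^ 2)| :=
        abs_add_le _ _
    _ ≤ A * W + |β| / x ^ 2 * (2 * W / r + 2 * W / r) := by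
        gcongr
        · rw [abs_mul, abs_neg, abs_of_nonneg hA0]
          gcongr
          linarith
        · rw [abs_mul, abs_div, abs_of_pos (by positivity : 0 < x ^ 2)]
          gcongr
          exact (abs_sub _ _).trans (add_le_add hq hp)
    _ = _ := by field_simp; ring

/-- The adiabatic energy is comparable at any two points before the turning point. -/
lemma oscEnergy_comparison {N β : ℝ} {h h₁ : ℝ → ℝ} {x₀ x Θ : ℝ} (hx₀ : 0 < x₀) (hxx : x₀ ≤ x)
    (hx : x ^ 2 < N) (ha : x ≤ Real.sqrt (N - x ^ 2) ^ 3)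
    (hh : ∀ t > 0, HasDerivAt h (h₁ t) t)
    (hh₁ : ∀ t > 0, HasDerivAt h₁ (-(N - t ^ 2 - β / t ^ 2) * h t) t)
    (hΘ : 1 + 4 * |β| / (Real.sqrt N * x₀) ≤ Θ) :
    Real.exp (-Θ) / 3 * oscEnergy N h h₁ x₀ ≤ oscEnergy N h h₁ x ∧
      oscEnergy N h h₁ x ≤ 3 * Real.exp Θ * oscEnergy N h h₁ x₀ := by
  have hN : 0 < N := by nlinarith
  have hlt : ∀ t ∈ Set.Icc x₀ x, 0 < t ∧ t ^ 2 < N ∧ t ≤ Real.sqrt (N - t ^ 2) ^ 3 := by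
    intro t ht
    have ht0 : 0 < t := hx₀.trans_le ht.1
    have ht2 : t ^ 2 ≤ x ^ 2 := by
      have := ht.2; gcongr
    refine ⟨ht0, by linarith, ht.2.trans (ha.trans ?_)⟩
    gcongr
  have hderW := fun t (ht : t ∈ Set.Icc x₀ x) =>
    hasDerivAt_oscEnergyCorr (hlt t ht).2.1 (hh t (hlt t ht).1) (hh₁ t (hlt t ht).1)
  have hderR := fun t (ht : t ∈ Set.Icc x₀ x) =>
    hasDerivAt_oscRate (β := β) (hlt t ht).1 (hlt t ht).2.1
  have hmono : MonotoneOn (fun t => oscEnergyCorr N h h₁ t * Real.exp (oscRate N β t))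
      (Set.Icc x₀ x) := by
    refine monotoneOn_of_hasDerivWithinAt_nonneg (convex_Icc _ _) (fun t ht =>
      ((hderW t ht).mul (hderR t ht).exp).continuousAt.continuousWithinAt)
      (fun t ht => ((hderW t (interior_subset ht)).mul
        (hderR t (interior_subset ht)).exp).hasDerivWithinAt) (fun t ht => ?_)
    have ht' := hlt t (interior_subset ht)
    have := (abs_le.1 (abs_deriv_oscEnergyCorr_le (β := β) (h := h) (h₁ := h₁)
      ht'.1 ht'.2.1 ht'.2.2)).1
    have := mul_le_mul_of_nonneg_left this (Real.exp_pos (oscRate N β t)).le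
    linarith
  have hanti : AntitoneOn (fun t => oscEnergyCorr N h h₁ t * Real.exp (-oscRate N β t))
      (Set.Icc x₀ x) := by
    refine antitoneOn_of_hasDerivWithinAt_nonpos (convex_Icc _ _) (fun t ht =>
      ((hderW t ht).mul (hderR t ht).neg.exp).continuousAt.continuousWithinAt)
      (fun t ht => ((hderW t (interior_subset ht)).mul
        (hderR t (interior_subset ht)).neg.exp).hasDerivWithinAt) (fun t ht => ?_)
    have ht' := hlt t (interior_subset ht)
    have := (abs_le.1 (abs_deriv_oscEnergyCorr_le (β := β) (h := h) (h₁ := h₁)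
      ht'.1 ht'.2.1 ht'.2.2)).2
    have := mul_le_mul_of_nonneg_left this (Real.exp_pos (-oscRate N β t)).le
    simp only [Pi.neg_apply]
    linarith
  have hx₀m : x₀ ∈ Set.Icc x₀ x := ⟨le_rfl, hxx⟩
  have hxm : x ∈ Set.Icc x₀ x := ⟨hxx, le_rfl⟩
  have h1 := hmono hx₀m hxm hxx
  have h2 := hanti hx₀m hxm hxx
  have hΔ : oscRate N β x - oscRate N β x₀ ≤ Θ := by
    refine le_trans ?_ hΘ
    have p1 : x / Real.sqrt (N - x ^ 2) ^ 3 ≤ 1 := by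
      have : 0 < Real.sqrt (N - x ^ 2) := Real.sqrt_pos.2 (by linarith)
      exact (div_le_one (by positivity)).2 ha
    have p2 : 0 ≤ 4 * |β| / N * (Real.sqrt (N - x ^ 2) / x) := by
      have := hx₀.trans_le hxx
      positivity
    have p3 : 0 ≤ x₀ / Real.sqrt (N - x₀ ^ 2) ^ 3 := by positivity
    have p4 : 4 * |β| / N * (Real.sqrt (N - x₀ ^ 2) / x₀) ≤ 4 * |β| / (Real.sqrt N * x₀) := by
      have : 4 * |β| / (Real.sqrt N * x₀) = 4 * |β| / N * (Real.sqrt N / x₀) := by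
        have hs0 : 0 < Real.sqrt N := Real.sqrt_pos.2 hN
        field_simp
        rw [Real.sq_sqrt hN.le]
      rw [this]
      gcongr
      nlinarith
    rw [oscRate, oscRate]
    linarith
  have b₀ := oscEnergyCorr_bounds h h₁ (hlt x₀ hx₀m).1 (hlt x₀ hx₀m).2.1 (hlt x₀ hx₀m).2.2
  have b := oscEnergyCorr_bounds h h₁ (hlt x hxm).1 (hlt x hxm).2.1 (hlt x hxm).2.2
  have hE₀ := oscEnergy_nonneg N h h₁ x₀
  have hE := oscEnergy_nonneg N h h₁ x
  simp only at h1 h2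
  have k1 : oscEnergyCorr N h h₁ x₀ * Real.exp (-Θ) ≤ oscEnergyCorr N h h₁ x := by
    have : oscEnergyCorr N h h₁ x₀ * Real.exp (oscRate N β x₀ - oscRate N β x) ≤
        oscEnergyCorr N h h₁ x := by
      rw [Real.exp_sub, ← mul_div_assoc, div_le_iff₀ (Real.exp_pos _)]
      exact h1
    refine le_trans ?_ this
    gcongr
    · linarith
    · linarith
  have k2 : oscEnergyCorr N h h₁ x ≤ oscEnergyCorr N h h₁ x₀ * Real.exp Θ := by
    have : oscEnergyCorr N h h₁ x ≤
        oscEnergyCorr N h h₁ x₀ * Real.exp (oscRate N β x - oscRate N β x₀) := by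
      rw [Real.exp_neg, Real.exp_neg, ← div_eq_mul_inv, ← div_eq_mul_inv,
        div_le_div_iff₀ (Real.exp_pos _) (Real.exp_pos _)] at h2
      rw [Real.exp_sub, ← mul_div_assoc, le_div_iff₀ (Real.exp_pos _)]
      exact h2
    refine this.trans ?_
    gcongr
    linarith
  have e1 := Real.exp_pos Θ
  have e2 := Real.exp_pos (-Θ)
  constructor
  · nlinarith [mul_le_mul_of_nonneg_right b₀.1 e2.le]
  · nlinarith [mul_le_mul_of_nonneg_right b₀.2 e1.le]

lemma two_le_nuR (a k : ℕ) : 2 ≤ nuR a k := by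
  have h1 : (0 : ℝ) ≤ k := k.cast_nonneg
  have h2 : (0 : ℝ) ≤ a := a.cast_nonneg
  unfold nuR; linarith

lemma lagPhi_zero_pos (a k : ℕ) : 0 < lagPhi a k 0 := by
  rw [lagPhi_zero]
  have := lagR_pos a k
  positivity

/-- The weight `x^(a + 1/2)`. -/
def lagW (a : ℕ) (x : ℝ) : ℝ := x ^ a * Real.sqrt x

lemma lagW_sq (a : ℕ) {x : ℝ} (hx : 0 ≤ x) : lagW a x ^ 2 = x ^ (2 * a + 1) := by
  rw [lagW, mul_pow, Real.sq_sqrt hx]; ring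

lemma lagW_pos (a : ℕ) {x : ℝ} (hx : 0 < x) : 0 < lagW a x := by
  unfold lagW; positivity

lemma lagW_mono (a : ℕ) {x y : ℝ} (hx : 0 ≤ x) (h : x ≤ y) : lagW a x ≤ lagW a y := by
  have := hx.trans h
  unfold lagW; gcongr

lemma hasDerivAt_lagW (a : ℕ) {x : ℝ} (hx : 0 < x) :
    HasDerivAt (lagW a) ((a + 1 / 2) / x * lagW a x) x := by
  refine ((hasDerivAt_pow a x).mul (Real.hasDerivAt_sqrt hx.ne')).congr_deriv ?_
  have hr : 0 < Real.sqrt x := Real.sqrt_pos.2 hx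
  have hs : x = Real.sqrt x * Real.sqrt x := (Real.mul_self_sqrt hx.le).symm
  rw [lagW]
  rcases a with _ | a
  · simp
    field_simp
    rw [Real.sq_sqrt hx.le]
  · simp only [Nat.add_sub_cancel]
    field_simp
    rw [Real.sq_sqrt hx.le]
    push_cast
    ring

/-- The Laguerre function in Liouville normal form. -/
def lagH (a k : ℕ) (x : ℝ) : ℝ := lagW a x * lagPhi a k (x ^ 2)

/-- The derivative of `lagH`. -/
def lagH₁ (a k : ℕ) (x : ℝ) : ℝ :=
  lagW a x * ((a + 1 / 2) / x * lagPhi a k (x ^ 2) + 2 * x * lagPhi₁ a k (x ^ 2))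

lemma hasDerivAt_comp_sq {f : ℝ → ℝ} {f' x : ℝ} (hf : HasDerivAt f f' (x ^ 2)) :
    HasDerivAt (fun x => f (x ^ 2)) (f' * (2 * x)) x := by
  have h : HasDerivAt (fun x : ℝ => x ^ 2) (2 * x) x := by simpa using hasDerivAt_pow 2 x
  exact HasDerivAt.comp (h := fun x : ℝ => x ^ 2) (h₂ := f) x hf h

lemma hasDerivAt_lagH (a k : ℕ) {x : ℝ} (hx : 0 < x) :
    HasDerivAt (lagH a k) (lagH₁ a k x) x := by
  refine ((hasDerivAt_lagW a hx).mul
    (hasDerivAt_comp_sq (hasDerivAt_lagPhi a k (x ^ 2)))).congr_deriv ?_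
  rw [lagH₁]; ring

lemma hasDerivAt_lagH₁ (a k : ℕ) {x : ℝ} (hx : 0 < x) :
    HasDerivAt (lagH₁ a k) (-(nuR a k - x ^ 2 - ((a : ℝ) ^ 2 - 1 / 4) / x ^ 2) * lagH a k x) x := by
  refine ((hasDerivAt_lagW a hx).mul ((((hasDerivAt_const x ((a : ℝ) + 1 / 2)).div
    (hasDerivAt_id x) hx.ne').mul
    (hasDerivAt_comp_sq (hasDerivAt_lagPhi a k (x ^ 2)))).add
    (((hasDerivAt_id x).const_mul 2).mul
      (hasDerivAt_comp_sq (hasDerivAt_lagPhi₁ a k (x ^ 2)))))).congr_deriv ?_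
  have ode := lagPhi_ode a k (x ^ 2)
  simp only [id, Pi.add_apply, Pi.mul_apply, Pi.div_apply]
  rw [lagH]
  have e : lagW a x * (4 * (x ^ 2 * lagPhi₂ a k (x ^ 2) + (a + 1) * lagPhi₁ a k (x ^ 2)
    + (nuR a k - x ^ 2) / 4 * lagPhi a k (x ^ 2))) = 0 := by rw [ode]; ring
  rw [← sub_eq_zero]
  refine Eq.trans ?_ e
  field_simp
  ring

lemma hasDerivAt_lagG_sq (a k : ℕ) {x : ℝ} (hx : 0 < x) :
    HasDerivAt (fun x => lagG a k (x ^ 2)) (2 * lagW a x * lagH a k x) x := by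
  refine (hasDerivAt_comp_sq (hasDerivAt_lagG a k (x ^ 2))).congr_deriv ?_
  rw [lagH]
  calc _ = 2 * x ^ (2 * a + 1) * lagPhi a k (x ^ 2) := by ring
    _ = _ := by rw [← lagW_sq a hx.le]; ring

/-- The numerator `s^(a+1) φ'(s)` of the Sturm–Liouville form of the Laguerre equation. -/
def lagP (a k : ℕ) (s : ℝ) : ℝ := s ^ (a + 1) * lagPhi₁ a k s

lemma hasDerivAt_lagP (a k : ℕ) (s : ℝ) :
    HasDerivAt (lagP a k) (-(s ^ a * ((nuR a k - s) / 4) * lagPhi a k s)) s := by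
  refine ((hasDerivAt_pow (a + 1) s).mul (hasDerivAt_lagPhi₁ a k s)).congr_deriv ?_
  have e : s ^ a * (s * lagPhi₂ a k s + (a + 1) * lagPhi₁ a k s + (nuR a k - s) / 4 * lagPhi a k s)
    = 0 := by rw [lagPhi_ode]; ring
  simp only [Nat.add_sub_cancel]
  rw [← sub_eq_zero, ← e]
  push_cast
  ring

lemma abs_lagPhi_le (a k : ℕ) {s : ℝ} (hs : 0 ≤ s) (hsN : s ≤ nuR a k / 2) :
    |lagPhi a k s| ≤ lagPhi a k 0 := by
  have hN := nuR_pos a k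
  set N := nuR a k with hNdef
  have hd : ∀ t ∈ Set.Icc 0 (N / 2), HasDerivAt
      (fun t => lagPhi a k t ^ 2 + 4 * t / (N - t) * lagPhi₁ a k t ^ 2)
      (-(lagPhi₁ a k t ^ 2 * (4 * (2 * (a + 1) * (N - t) - N) / (N - t) ^ 2))) t := by
    intro t ht
    have hne : N - t ≠ 0 := by have := ht.2; linarith
    refine (((hasDerivAt_lagPhi a k t).pow 2).add
      ((((hasDerivAt_id t).const_mul 4).div ((hasDerivAt_id t).const_sub N) hne).mul
        ((hasDerivAt_lagPhi₁ a k t).pow 2))).congr_deriv ?_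
    have e : 8 / (N - t) * lagPhi₁ a k t * (t * lagPhi₂ a k t + (a + 1) * lagPhi₁ a k t
      + (N - t) / 4 * lagPhi a k t) = 0 := by rw [hNdef, lagPhi_ode]; ring
    simp only [id, Pi.pow_apply, Pi.div_apply]
    rw [← sub_eq_zero, ← e]
    field_simp
    ring
  have hanti : AntitoneOn (fun t => lagPhi a k t ^ 2 + 4 * t / (N - t) * lagPhi₁ a k t ^ 2)
      (Set.Icc 0 (N / 2)) := by
    refine antitoneOn_of_hasDerivWithinAt_nonpos (convex_Icc _ _)
      (fun t ht => (hd t ht).continuousAt.continuousWithinAt)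
      (fun t ht => (hd t (interior_subset ht)).hasDerivWithinAt) (fun t ht => ?_)
    have ht := interior_subset ht
    have h1 : 0 ≤ 2 * ((a : ℝ) + 1) * (N - t) - N := by
      have h2 : (0 : ℝ) ≤ a := a.cast_nonneg
      have := ht.2
      nlinarith
    have : 0 ≤ lagPhi₁ a k t ^ 2 * (4 * (2 * (a + 1) * (N - t) - N) / (N - t) ^ 2) := by positivity
    linarith
  have h := hanti ⟨le_rfl, by positivity⟩ ⟨hs, hsN⟩ hs
  simp only [mul_zero, zero_div, zero_mul, add_zero] at h
  have hpos : 0 ≤ 4 * s / (N - s) * lagPhi₁ a k s ^ 2 := by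
    have : 0 < N - s := by linarith
    positivity
  exact abs_le_of_sq_le_sq (by linarith) (lagPhi_zero_pos a k).le

lemma abs_lagPhi₁_le (a k : ℕ) {s : ℝ} (hs : 0 < s) (hsN : s ≤ nuR a k / 2) :
    |lagPhi₁ a k s| ≤ nuR a k / 4 * lagPhi a k 0 := by
  have hN := nuR_pos a k
  set N := nuR a k with hNdef
  have h0 := lagPhi_zero_pos a k
  set φ₀ := lagPhi a k 0
  have ha : (0 : ℝ) ≤ a := a.cast_nonneg
  have hd : ∀ t ∈ interior (Set.Icc 0 s), |t ^ a * ((N - t) / 4) * lagPhi a k t| ≤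
      N / 4 * φ₀ * ((a + 1) * t ^ a) := by
    intro t ht
    rw [interior_Icc] at ht
    have hφ := abs_lagPhi_le a k ht.1.le (by linarith [ht.2])
    have h1 : 0 < N - t := by linarith [ht.2]
    have h2 := ht.1
    rw [abs_mul, abs_of_nonneg (by positivity)]
    calc _ ≤ t ^ a * (N / 4) * φ₀ := by gcongr; linarith
      _ = N / 4 * φ₀ * (1 * t ^ a) := by ring
      _ ≤ _ := by gcongr; linarith
  have hpow : ∀ t, HasDerivAt (fun t : ℝ => N / 4 * φ₀ * t ^ (a + 1))
      (N / 4 * φ₀ * ((a + 1) * t ^ a)) t := fun t =>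
    ((hasDerivAt_pow (a + 1) t).const_mul (N / 4 * φ₀)).congr_deriv (by simp)
  have hm : MonotoneOn (fun t => lagP a k t + N / 4 * φ₀ * t ^ (a + 1)) (Set.Icc 0 s) := by
    refine monotoneOn_of_hasDerivWithinAt_nonneg (convex_Icc _ _)
      (fun t _ => ((hasDerivAt_lagP a k t).add (hpow t)).continuousAt.continuousWithinAt)
      (fun t _ => ((hasDerivAt_lagP a k t).add (hpow t)).hasDerivWithinAt) (fun t ht => ?_)
    have := (abs_le.1 (hd t ht)).2
    linarith
  have ht : AntitoneOn (fun t => lagP a k t - N / 4 * φ₀ * t ^ (a + 1)) (Set.Icc 0 s) := by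
    refine antitoneOn_of_hasDerivWithinAt_nonpos (convex_Icc _ _)
      (fun t _ => ((hasDerivAt_lagP a k t).sub (hpow t)).continuousAt.continuousWithinAt)
      (fun t _ => ((hasDerivAt_lagP a k t).sub (hpow t)).hasDerivWithinAt) (fun t ht => ?_)
    have := (abs_le.1 (hd t ht)).1
    linarith
  have h1 := hm ⟨le_rfl, hs.le⟩ ⟨hs.le, le_rfl⟩ hs.le
  have h2 := ht ⟨le_rfl, hs.le⟩ ⟨hs.le, le_rfl⟩ hs.le
  simp only [lagP, ne_eq, Nat.add_eq_zero_iff, one_ne_zero, and_false, not_false_eq_true, zero_pow,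
    zero_mul, mul_zero, add_zero, sub_zero] at h1 h2
  have hsp : 0 < s ^ (a + 1) := by positivity
  rw [abs_le]
  constructor
  · refine le_of_mul_le_mul_left ?_ hsp
    linarith
  · refine le_of_mul_le_mul_left ?_ hsp
    linarith

lemma lagPhi_ge (a k : ℕ) {s : ℝ} (hs : 0 ≤ s) (hsN : s ≤ 1 / nuR a k) :
    3 / 4 * lagPhi a k 0 ≤ lagPhi a k s := by
  have hN := two_le_nuR a k
  have h0 := lagPhi_zero_pos a k
  have hN1 : 1 / nuR a k ≤ nuR a k / 2 := by
    rw [div_le_div_iff₀ (by linarith) (by norm_num)]; nlinarith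
  have hd : ∀ t, HasDerivAt (fun t => lagPhi a k t + nuR a k / 4 * lagPhi a k 0 * t)
      (lagPhi₁ a k t + nuR a k / 4 * lagPhi a k 0) t := fun t =>
    ((hasDerivAt_lagPhi a k t).add ((hasDerivAt_id t).const_mul _)).congr_deriv (by simp)
  have hm : MonotoneOn (fun t => lagPhi a k t + nuR a k / 4 * lagPhi a k 0 * t) (Set.Icc 0 s) := by
    refine monotoneOn_of_hasDerivWithinAt_nonneg (convex_Icc _ _)
      (fun t _ => (hd t).continuousAt.continuousWithinAt)
      (fun t _ => (hd t).hasDerivWithinAt) (fun t ht => ?_)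
    rw [interior_Icc] at ht
    have := (abs_le.1 (abs_lagPhi₁_le a k ht.1 (by linarith [ht.2]))).1
    linarith
  have h := hm ⟨le_rfl, hs⟩ ⟨hs, le_rfl⟩ hs
  simp only [mul_zero, add_zero] at h
  have hs1 : nuR a k * s ≤ 1 := by
    rw [le_div_iff₀ (by linarith)] at hsN; linarith
  nlinarith

/-- The size `N^(-a) φ(0)²` of the energy of `lagH`. -/
def lagE (a k : ℕ) : ℝ := lagPhi a k 0 ^ 2 / nuR a k ^ a

lemma lagE_pos (a k : ℕ) : 0 < lagE a k := by
  have := nuR_pos a k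
  have := lagPhi_zero_pos a k
  unfold lagE; positivity

lemma oscEnergy_lagH_start (a k : ℕ) :
    1 / 4 * lagE a k ≤ oscEnergy (nuR a k) (lagH a k) (lagH₁ a k) (1 / Real.sqrt (nuR a k)) ∧
      oscEnergy (nuR a k) (lagH a k) (lagH₁ a k) (1 / Real.sqrt (nuR a k)) ≤
        (1 + 2 * ((a : ℝ) + 1) ^ 2) * lagE a k := by
  have hN := two_le_nuR a k
  set N := nuR a k with hNdef
  have hr0 : 0 < Real.sqrt N := Real.sqrt_pos.2 (by linarith)
  set R := Real.sqrt N with hR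
  have hRN : R ^ 2 = N := Real.sq_sqrt (by linarith)
  have hx2 : (1 / R) ^ 2 = 1 / N := by rw [div_pow, hRN, one_pow]
  have hx0 : 0 < 1 / R := by positivity
  have hN1 : 1 / N ≤ N / 2 := by
    rw [div_le_div_iff₀ (by linarith) (by norm_num)]; nlinarith
  have hNi : 0 < 1 / N := by positivity
  have h0 := lagPhi_zero_pos a k
  have hφ := abs_le.1 (abs_lagPhi_le a k hNi.le hN1)
  have hφ' := abs_le.1 (abs_lagPhi₁_le a k hNi hN1)
  have hφl := lagPhi_ge a k hNi.le le_rfl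
  have hw : lagW a (1 / R) ^ 2 = 1 / (N ^ a * R) := by
    rw [lagW_sq a hx0.le, div_pow, one_pow, pow_succ, pow_mul, hRN]
  rw [oscEnergy, lagH, lagH₁, hx2, lagE]
  set φ₀ := lagPhi a k 0
  set φ := lagPhi a k (1 / N)
  set ψ := lagPhi₁ a k (1 / N)
  have hrl : R / 2 ≤ Real.sqrt (N - 1 / N) := by
    apply Real.le_sqrt_of_sq_le
    rw [div_pow, hRN]; linarith
  have hru : Real.sqrt (N - 1 / N) ≤ R := Real.sqrt_le_sqrt (by linarith)
  set r := Real.sqrt (N - 1 / N)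
  have hr : 0 < r := by linarith
  have ha : (0 : ℝ) ≤ a := a.cast_nonneg
  have hNa : 0 < N ^ a := by positivity
  rw [mul_pow, mul_pow, hw]
  have hsq1 : φ ^ 2 ≤ φ₀ ^ 2 := by nlinarith
  have hsq2 : (3 / 4 * φ₀) ^ 2 ≤ φ ^ 2 := by gcongr
  have e2 : r * (1 / (N ^ a * R) * φ ^ 2) = r / R * (φ ^ 2 / N ^ a) := by field_simp
  have hrR : 1 / 2 ≤ r / R := by rw [le_div_iff₀ hr0]; linarith
  have hrR' : r / R ≤ 1 := (div_le_one hr0).2 hru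
  rw [e2]
  have e1 : 1 / (N ^ a * R) * (((a : ℝ) + 1 / 2) / (1 / R) * φ + 2 * (1 / R) * ψ) ^ 2 / r =
      1 / N ^ a * ((R / r) * (((a : ℝ) + 1 / 2) * φ + 2 * (ψ / N)) ^ 2) := by
    rw [← hRN]; field_simp
  rw [e1]
  have hψ : |2 * (ψ / N)| ≤ 1 / 2 * φ₀ := by
    rw [abs_mul, abs_div, abs_of_pos (by linarith : 0 < N), abs_two, ← mul_div_assoc,
      div_le_iff₀ (by linarith)]
    have := abs_le.2 hφ'
    linarith
  have hb : |((a : ℝ) + 1 / 2) * φ + 2 * (ψ / N)| ≤ (a + 1) * φ₀ := by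
    refine (abs_add_le _ _).trans ?_
    rw [abs_mul, abs_of_pos (by positivity : (0 : ℝ) < a + 1 / 2)]
    have := mul_le_mul_of_nonneg_left (abs_le.2 hφ) (by positivity : (0 : ℝ) ≤ a + 1 / 2)
    linarith
  have hb2 : (((a : ℝ) + 1 / 2) * φ + 2 * (ψ / N)) ^ 2 ≤ ((a + 1) * φ₀) ^ 2 := by
    rw [← sq_abs]; gcongr
  have hRr : R / r ≤ 2 := by rw [div_le_iff₀ hr]; linarith
  constructor
  · have t1 : 0 ≤ 1 / N ^ a * ((R / r) * (((a : ℝ) + 1 / 2) * φ + 2 * (ψ / N)) ^ 2) := by positivity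
    have t2 : 1 / 2 * ((3 / 4 * φ₀) ^ 2 / N ^ a) ≤ r / R * (φ ^ 2 / N ^ a) := by gcongr
    have t3 : 1 / 4 * (φ₀ ^ 2 / N ^ a) ≤ 1 / 2 * ((3 / 4 * φ₀) ^ 2 / N ^ a) := by
      rw [mul_pow, mul_div_assoc]
      have : 0 ≤ φ₀ ^ 2 / N ^ a := by positivity
      linarith
    linarith
  · have t1 : 1 / N ^ a * ((R / r) * (((a : ℝ) + 1 / 2) * φ + 2 * (ψ / N)) ^ 2) ≤
        1 / N ^ a * (2 * ((a + 1) * φ₀) ^ 2) := by gcongr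
    have t2 : r / R * (φ ^ 2 / N ^ a) ≤ 1 * (φ₀ ^ 2 / N ^ a) := by gcongr
    have t3 : 1 / N ^ a * (2 * (((a : ℝ) + 1) * φ₀) ^ 2) = 2 * ((a : ℝ) + 1) ^ 2 * (φ₀ ^ 2 / N ^ a) := by
      ring
    linarith

/-- Uniform two-sided energy bounds in the oscillatory region. -/
lemma exists_oscEnergy_lagH_bounds (a : ℕ) : ∃ c₁ > 0, ∃ c₂ > 0, ∀ k : ℕ, ∀ x : ℝ,
    1 / Real.sqrt (nuR a k) ≤ x → x ^ 2 < nuR a k → x ≤ Real.sqrt (nuR a k - x ^ 2) ^ 3 →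
    c₁ * lagE a k ≤ oscEnergy (nuR a k) (lagH a k) (lagH₁ a k) x ∧
      oscEnergy (nuR a k) (lagH a k) (lagH₁ a k) x ≤ c₂ * lagE a k := by
  set Θ : ℝ := 1 + 4 * |(a : ℝ) ^ 2 - 1 / 4| with hΘ
  refine ⟨Real.exp (-Θ) / 3 * (1 / 4), by positivity,
    3 * Real.exp Θ * (1 + 2 * ((a : ℝ) + 1) ^ 2), by positivity, fun k x h1 h2 h3 => ?_⟩
  have hr0 : 0 < Real.sqrt (nuR a k) := Real.sqrt_pos.2 (nuR_pos a k)
  have hc := oscEnergy_comparison (Θ := Θ) (by positivity) h1 h2 h3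
    (fun t ht => hasDerivAt_lagH a k ht) (fun t ht => hasDerivAt_lagH₁ a k ht) (by
      rw [mul_one_div, div_self hr0.ne', div_one])
  have hs := oscEnergy_lagH_start a k
  constructor
  · refine le_trans ?_ hc.1
    rw [mul_assoc]
    gcongr
    exact hs.1
  · refine hc.2.trans ?_
    rw [mul_assoc (3 * Real.exp Θ)]
    gcongr
    exact hs.2

/-- If `F(x₁) = F(x₂)` and `F' ≥ g - f`, then `∫ g ≤ ∫ f`. -/
lemma integral_le_integral_of_deriv_ge {F F' f g : ℝ → ℝ} {x₁ x₂ : ℝ} (h12 : x₁ ≤ x₂)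
    (hF : ∀ x ∈ Set.Icc x₁ x₂, HasDerivAt F (F' x) x) (h0 : F x₁ = F x₂)
    (hf : ContinuousOn f (Set.Icc x₁ x₂)) (hg : ContinuousOn g (Set.Icc x₁ x₂))
    (h : ∀ x ∈ Set.Icc x₁ x₂, g x ≤ F' x + f x) :
    ∫ x in x₁..x₂, g x ≤ ∫ x in x₁..x₂, f x := by
  have key := intervalIntegral.sub_le_integral_of_hasDeriv_right_of_le (g := fun x => -F x)
    (g' := fun x => -F' x) (φ := fun x => f x - g x) h12
    (fun x hx => (hF x hx).neg.continuousAt.continuousWithinAt)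
    (fun x hx => (hF x (Set.Ioo_subset_Icc_self hx)).neg.hasDerivWithinAt)
    ((hf.sub hg).integrableOn_Icc)
    (fun x hx => by have := h x (Set.Ioo_subset_Icc_self hx); linarith)
  rw [intervalIntegral.integral_sub (hf.intervalIntegrable_of_Icc h12)
    (hg.intervalIntegrable_of_Icc h12)] at key
  linarith

lemma integral_sub_mul_sub (x₁ x₂ : ℝ) :
    ∫ x in x₁..x₂, (x - x₁) * (x₂ - x) = (x₂ - x₁) ^ 3 / 6 := by
  have hd : ∀ x ∈ Set.uIcc x₁ x₂, HasDerivAt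
      (fun x => (x - x₁) ^ 2 / 2 * (x₂ - x₁) - (x - x₁) ^ 3 / 3) ((x - x₁) * (x₂ - x)) x := by
    intro x _
    have h := (hasDerivAt_id x).sub_const x₁
    refine ((((h.pow 2).div_const 2).mul_const (x₂ - x₁)).sub ((h.pow 3).div_const 3)).congr_deriv ?_
    simp only [id]
    push_cast
    ring
  rw [intervalIntegral.integral_eq_sub_of_hasDerivAt hd (by fun_prop : Continuous
    fun x => (x - x₁) * (x₂ - x)).continuousOn.intervalIntegrable]
  ring

lemma hasDerivAt_sub_mul_sub (x₁ x₂ x : ℝ) :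
    HasDerivAt (fun x => (x - x₁) * (x₂ - x)) (x₁ + x₂ - 2 * x) x :=
  (((hasDerivAt_id x).sub_const x₁).mul ((hasDerivAt_id x).const_sub x₂)).congr_deriv
    (by simp only [id]; ring)

section Window

variable {N β c₁ c₂ e : ℝ} {h h₁ : ℝ → ℝ} {x₁ x₂ : ℝ}

lemma integral_window_sq_ge (hx₁ : 0 < x₁) (h12 : x₁ < x₂) (hx₂ : x₂ ^ 2 < N)
    (hq : N - x₁ ^ 2 ≤ 4 * (N - x₂ ^ 2)) (hβ : |β| / x₁ ^ 2 ≤ N - x₂ ^ 2)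
    (hc₁ : 0 < c₁) (he : 0 < e)
    (hℓ : 6 * c₂ / c₁ ≤ (x₂ - x₁) * Real.sqrt (N - x₂ ^ 2))
    (hh : ∀ t > 0, HasDerivAt h (h₁ t) t)
    (hh₁ : ∀ t > 0, HasDerivAt h₁ (-(N - t ^ 2 - β / t ^ 2) * h t) t)
    (hE : ∀ x ∈ Set.Icc x₁ x₂, c₁ * e ≤ oscEnergy N h h₁ x ∧ oscEnergy N h h₁ x ≤ c₂ * e) :
    c₁ * e * (x₂ - x₁) ^ 3 / (108 * Real.sqrt (N - x₂ ^ 2)) ≤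
      ∫ x in x₁..x₂, (x - x₁) * (x₂ - x) * h x ^ 2 := by
  have hq2 : 0 < N - x₂ ^ 2 := by linarith
  have hr : 0 < Real.sqrt (N - x₂ ^ 2) := Real.sqrt_pos.2 hq2
  have hr2 : Real.sqrt (N - x₂ ^ 2) ^ 2 = N - x₂ ^ 2 := Real.sq_sqrt hq2.le
  set r := Real.sqrt (N - x₂ ^ 2) with hrdef
  have hpos : ∀ x ∈ Set.Icc x₁ x₂, 0 < x := fun x hx => hx₁.trans_le hx.1
  have hcont : ContinuousOn h (Set.Icc x₁ x₂) := fun x hx =>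
    (hh x (hpos x hx)).continuousAt.continuousWithinAt
  have key := integral_le_integral_of_deriv_ge
    (F := fun x => (x - x₁) * (x₂ - x) * (h x * h₁ x))
    (F' := fun x => (x₁ + x₂ - 2 * x) * (h x * h₁ x) + (x - x₁) * (x₂ - x) * (h₁ x * h₁ x +
      h x * (-(N - x ^ 2 - β / x ^ 2) * h x)))
    (f := fun x => (x₂ - x₁) * (c₂ * e / 2) + 9 * r ^ 2 * ((x - x₁) * (x₂ - x) * h x ^ 2))
    (g := fun x => r * (c₁ * e) * ((x - x₁) * (x₂ - x))) h12.le
    (fun x hx => (hasDerivAt_sub_mul_sub x₁ x₂ x).mul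
      ((hh x (hpos x hx)).mul (hh₁ x (hpos x hx)))) (by simp)
    (by fun_prop) (by fun_prop) (by
      intro x hx
      have hx0 := hpos x hx
      have hxx : x ^ 2 ≤ x₂ ^ 2 := by have := hx.2; gcongr
      have hxx1 : x₁ ^ 2 ≤ x ^ 2 := by have := hx.1; gcongr
      have hxN : x ^ 2 < N := by linarith
      obtain ⟨hE1, hE2⟩ := hE x hx
      have hab := abs_mul_le_oscEnergy h h₁ hxN
      have hχ : 0 ≤ (x - x₁) * (x₂ - x) :=
        mul_nonneg (sub_nonneg.2 hx.1) (sub_nonneg.2 hx.2)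
      have hχ' : |x₁ + x₂ - 2 * x| ≤ x₂ - x₁ := by
        rw [abs_le]; constructor <;> linarith [hx.1, hx.2]
      have b1 : |(x₁ + x₂ - 2 * x) * (h x * h₁ x)| ≤ (x₂ - x₁) * (c₂ * e / 2) := by
        rw [abs_mul]
        have : 0 ≤ x₂ - x₁ := by linarith
        gcongr
        linarith
      have b2 : |β / x ^ 2| ≤ r ^ 2 := by
        rw [hr2, abs_div, abs_of_pos (by positivity : 0 < x ^ 2)]
        refine le_trans ?_ hβ
        gcongr
      set s := Real.sqrt (N - x ^ 2) with hs
      have hsr : r ≤ s := Real.sqrt_le_sqrt (by linarith)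
      have hs2 : s ^ 2 = N - x ^ 2 := Real.sq_sqrt (by linarith)
      have hs0 : 0 < s := hr.trans_le hsr
      have b3 : r * (c₁ * e) ≤ h₁ x ^ 2 + s ^ 2 * h x ^ 2 := by
        have : s * oscEnergy N h h₁ x = h₁ x ^ 2 + s ^ 2 * h x ^ 2 := by
          rw [oscEnergy, ← hs]; field_simp
        rw [← this]
        gcongr
      have b4 : s ^ 2 ≤ 4 * r ^ 2 := by rw [hr2, hs2]; linarith
      have b5 : r * (c₁ * e) ≤
          (h₁ x * h₁ x + h x * (-(N - x ^ 2 - β / x ^ 2) * h x)) + 9 * r ^ 2 * h x ^ 2 := by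
        rw [← hs2]
        have h2 := (abs_le.1 b2).1
        have : 0 ≤ (9 * r ^ 2 - 2 * s ^ 2 + β / x ^ 2) * h x ^ 2 := by
          apply mul_nonneg _ (sq_nonneg _); linarith
        linarith
      have b6 := mul_le_mul_of_nonneg_left b5 hχ
      have := (abs_le.1 b1).1
      linarith)
  rw [intervalIntegral.integral_const_mul, integral_sub_mul_sub, intervalIntegral.integral_add
    (by simp) (ContinuousOn.intervalIntegrable_of_Icc h12.le (by fun_prop)),
    intervalIntegral.integral_const_mul (9 * r ^ 2), intervalIntegral.integral_const,
    smul_eq_mul] at key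
  set I := ∫ x in x₁..x₂, (x - x₁) * (x₂ - x) * h x ^ 2
  rw [div_le_iff₀ (by positivity)]
  set ℓ := x₂ - x₁
  have hℓ0 : 0 < ℓ := by simp only [ℓ]; linarith
  rw [div_le_iff₀ hc₁] at hℓ
  have h6 : 6 * c₂ * (e * ℓ ^ 2) ≤ ℓ * r * c₁ * (e * ℓ ^ 2) := by gcongr
  refine le_of_mul_le_mul_left ?_ hr
  linarith

lemma integral_window_ge {y w : ℝ → ℝ} {w₁ : ℝ} (hx₁ : 0 < x₁) (h12 : x₁ < x₂) (hx₂ : x₂ ^ 2 < N)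
    (hq : N - x₁ ^ 2 ≤ 4 * (N - x₂ ^ 2)) (hβ : |β| / x₁ ^ 2 ≤ N - x₂ ^ 2)
    (hc₁ : 0 < c₁) (hc₂ : 0 < c₂) (he : 0 < e)
    (hℓ : 6 * c₂ / c₁ ≤ (x₂ - x₁) * Real.sqrt (N - x₂ ^ 2))
    (hℓ1 : 1 ≤ (x₂ - x₁) * Real.sqrt (N - x₂ ^ 2))
    (hh : ∀ t > 0, HasDerivAt h (h₁ t) t)
    (hh₁ : ∀ t > 0, HasDerivAt h₁ (-(N - t ^ 2 - β / t ^ 2) * h t) t)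
    (hE : ∀ x ∈ Set.Icc x₁ x₂, c₁ * e ≤ oscEnergy N h h₁ x ∧ oscEnergy N h h₁ x ≤ c₂ * e)
    (hy : ∀ t > 0, HasDerivAt y (w t * h t) t) (hw₁ : 0 < w₁)
    (hw : ∀ x ∈ Set.Icc x₁ x₂, w₁ ≤ w x) :
    c₁ ^ 2 / (34992 * c₂) * (w₁ ^ 2 * e * (x₂ - x₁) / Real.sqrt (N - x₂ ^ 2) ^ 3) ≤
      ∫ x in x₁..x₂, y x ^ 2 := by
  have hA := integral_window_sq_ge hx₁ h12 hx₂ hq hβ hc₁ he hℓ hh hh₁ hE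
  have hq2 : 0 < N - x₂ ^ 2 := by linarith
  have hr : 0 < Real.sqrt (N - x₂ ^ 2) := Real.sqrt_pos.2 hq2
  have hr2 : Real.sqrt (N - x₂ ^ 2) ^ 2 = N - x₂ ^ 2 := Real.sq_sqrt hq2.le
  set r := Real.sqrt (N - x₂ ^ 2) with hrdef
  set ℓ := x₂ - x₁ with hℓdef
  have hℓ0 : 0 < ℓ := by simp only [ℓ]; linarith
  set A := c₁ * e * ℓ ^ 3 / (108 * r) with hAdef
  have hA0 : 0 < A := by positivity
  set B := 3 * c₂ * e * ℓ ^ 4 * r with hBdef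
  have hB0 : 0 < B := by positivity
  set t := B * ℓ / (w₁ * A) with htdef
  have ht0 : 0 < t := by positivity
  have hpos : ∀ x ∈ Set.Icc x₁ x₂, 0 < x := fun x hx => hx₁.trans_le hx.1
  have hcont : ContinuousOn h (Set.Icc x₁ x₂) := fun x hx =>
    (hh x (hpos x hx)).continuousAt.continuousWithinAt
  have hconty : ContinuousOn y (Set.Icc x₁ x₂) := fun x hx =>
    (hy x (hpos x hx)).continuousAt.continuousWithinAt
  have key := integral_le_integral_of_deriv_ge
    (F := fun x => y x * ((x - x₁) * (x₂ - x) * h x))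
    (F' := fun x => w x * h x * ((x - x₁) * (x₂ - x) * h x) +
      y x * ((x₁ + x₂ - 2 * x) * h x + (x - x₁) * (x₂ - x) * h₁ x))
    (f := fun x => t / 2 * y x ^ 2 + B / (2 * t))
    (g := fun x => w₁ * ((x - x₁) * (x₂ - x) * h x ^ 2)) h12.le
    (fun x hx => (hy x (hpos x hx)).mul ((hasDerivAt_sub_mul_sub x₁ x₂ x).mul (hh x (hpos x hx))))
    (by simp) (by fun_prop) (by fun_prop) (by
      intro x hx
      have hxx : x ^ 2 ≤ x₂ ^ 2 := by have := hx.2; have := hpos x hx; gcongr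
      have hxx1 : x₁ ^ 2 ≤ x ^ 2 := by have := hx.1; gcongr
      have hE2 := (hE x hx).2
      have hχ1 : 0 ≤ (x - x₁) * (x₂ - x) :=
        mul_nonneg (sub_nonneg.2 hx.1) (sub_nonneg.2 hx.2)
      have hχ2 : (x - x₁) * (x₂ - x) ≤ ℓ ^ 2 / 4 := by
        rw [hℓdef]; nlinarith [sq_nonneg ((x - x₁) - (x₂ - x))]
      have hχ' : |x₁ + x₂ - 2 * x| ≤ ℓ := by
        rw [abs_le]; constructor <;> linarith [hx.1, hx.2]
      set s := Real.sqrt (N - x ^ 2) with hs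
      have hsr : r ≤ s := Real.sqrt_le_sqrt (by linarith)
      have hs2 : s ^ 2 = N - x ^ 2 := Real.sq_sqrt (by linarith)
      have hs0 : 0 < s := hr.trans_le hsr
      have hsr2 : s ≤ 2 * r := by
        refine abs_le_of_sq_le_sq' ?_ (by positivity) |>.2
        rw [mul_pow, hr2, hs2]; linarith
      rw [oscEnergy, ← hs] at hE2
      have hp1 : 0 ≤ h₁ x ^ 2 / s := by positivity
      have hp2 : 0 ≤ s * h x ^ 2 := by positivity
      have k1 : h₁ x ^ 2 ≤ c₂ * e * (2 * r) := by
        have : h₁ x ^ 2 / s ≤ c₂ * e := by linarith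
        rw [div_le_iff₀ hs0] at this
        refine this.trans ?_
        gcongr
      have k2 : h x ^ 2 ≤ c₂ * e * (ℓ ^ 2 * r) := by
        have h1 : r * h x ^ 2 ≤ c₂ * e := by
          refine le_trans ?_ (by linarith : s * h x ^ 2 ≤ c₂ * e)
          gcongr
        have h2 : 1 ≤ (ℓ * r) ^ 2 := one_le_pow₀ hℓ1
        refine le_of_mul_le_mul_left ?_ hr
        calc r * h x ^ 2 ≤ c₂ * e * 1 := by linarith
          _ ≤ c₂ * e * (ℓ * r) ^ 2 := by gcongr
          _ = _ := by ring
      set z := (x₁ + x₂ - 2 * x) * h x + (x - x₁) * (x₂ - x) * h₁ x with hz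
      have hzB : z ^ 2 ≤ B := by
        have a1 : ((x₁ + x₂ - 2 * x) * h x) ^ 2 ≤ ℓ ^ 2 * (c₂ * e * (ℓ ^ 2 * r)) := by
          rw [mul_pow, ← sq_abs (x₁ + x₂ - 2 * x)]; gcongr
        have a2 : ((x - x₁) * (x₂ - x) * h₁ x) ^ 2 ≤ (ℓ ^ 2 / 4) ^ 2 * (c₂ * e * (2 * r)) := by
          rw [mul_pow]; gcongr
        have a3 : 0 ≤ c₂ * e * ℓ ^ 4 * r := by positivity
        have a4 := sq_nonneg ((x₁ + x₂ - 2 * x) * h x - (x - x₁) * (x₂ - x) * h₁ x)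
        rw [hBdef, hz]
        linarith
      have hyz : -(y x * z) ≤ t / 2 * y x ^ 2 + B / (2 * t) := by
        have : 0 ≤ (t * y x + z) ^ 2 / (2 * t) := by positivity
        have e1 : (t * y x + z) ^ 2 / (2 * t) = t / 2 * y x ^ 2 + y x * z + z ^ 2 / (2 * t) := by
          field_simp; ring
        have e2 : z ^ 2 / (2 * t) ≤ B / (2 * t) := by gcongr
        linarith
      have hwx := mul_le_mul_of_nonneg_right (hw x hx) (mul_nonneg hχ1 (sq_nonneg (h x)))
      linarith)
  rw [intervalIntegral.integral_const_mul, intervalIntegral.integral_add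
    (ContinuousOn.intervalIntegrable_of_Icc h12.le (by fun_prop)) (by simp),
    intervalIntegral.integral_const_mul, intervalIntegral.integral_const, smul_eq_mul,
    ← hℓdef] at key
  set Y := ∫ x in x₁..x₂, y x ^ 2
  have hAw := mul_le_mul_of_nonneg_left hA hw₁.le
  have e1 : ℓ * (B / (2 * t)) = w₁ * A / 2 := by rw [htdef]; field_simp
  have e2 : w₁ * A / t ≤ Y := by
    rw [div_le_iff₀ ht0]; linarith
  refine le_trans (le_of_eq ?_) e2
  rw [htdef, hAdef, hBdef]
  field_simp
  norm_num
end Window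

lemma mul_integral_le_of_le {f g : ℝ → ℝ} {m u v : ℝ} (huv : u ≤ v) (hf : Continuous f)
    (hg : Continuous g) (hg0 : ∀ x, 0 ≤ g x) (h : ∀ x ∈ Set.Icc u v, m ≤ f x) :
    m * ∫ x in u..v, g x ≤ ∫ x in u..v, f x * g x := by
  rw [← intervalIntegral.integral_const_mul]
  refine intervalIntegral.integral_mono_on huv ((hg.const_mul m).intervalIntegrable _ _)
    ((hf.mul hg).intervalIntegrable _ _) fun x hx => ?_
  have := hg0 x
  have := h x hx
  gcongr

lemma pow_four_le_sin_sq {x : ℝ} (hx2 : x ^ 2 ≤ 1 / 2) :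
    x ^ 4 ≤ Real.sin (2 * x ^ 2) ^ 2 := by
  have h0 : 0 ≤ x ^ 2 := sq_nonneg x
  have h := Real.mul_le_sin (x := 2 * x ^ 2) (by positivity) (by linarith [Real.pi_gt_three])
  have h2 : 1 / 2 ≤ 2 / Real.pi := by
    rw [div_le_div_iff₀ (by norm_num) Real.pi_pos]; linarith [Real.pi_le_four]
  have h3 : x ^ 2 ≤ Real.sin (2 * x ^ 2) := by nlinarith
  calc x ^ 4 = (x ^ 2) ^ 2 := by ring
    _ ≤ _ := by gcongr

lemma continuous_lagG_sq (a k : ℕ) : Continuous fun x : ℝ => lagG a k (x ^ 2) ^ 2 := by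
  have := continuous_lagG a k
  fun_prop

lemma continuous_sin_sq : Continuous fun x : ℝ => Real.sin (2 * x ^ 2) ^ 2 := by fun_prop

/-- Restricting the averaged coefficient to a window on which `sin²` is bounded below. -/
lemma mul_integral_le_lagF (a k : ℕ) {m u v X : ℝ} (hu : 0 ≤ u) (huv : u ≤ v) (hv : v ≤ X)
    (h : ∀ x ∈ Set.Icc u v, m ≤ Real.sin (2 * x ^ 2) ^ 2) :
    m * ∫ x in u..v, lagG a k (x ^ 2) ^ 2 ≤ lagF a k X :=
  (mul_integral_le_of_le huv continuous_sin_sq (continuous_lagG_sq a k)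
    (fun _ => sq_nonneg _) h).trans (integral_le_lagF a k hu huv hv)

lemma lagG_ge (a k : ℕ) {s : ℝ} (hs : 0 ≤ s) (hsN : s ≤ 1 / nuR a k) :
    3 / (4 * (a + 1)) * lagPhi a k 0 * s ^ (a + 1) ≤ lagG a k s := by
  have hpow : ∀ t, HasDerivAt (fun t : ℝ => 3 / (4 * ((a : ℝ) + 1)) * lagPhi a k 0 * t ^ (a + 1))
      (3 / 4 * lagPhi a k 0 * t ^ a) t := fun t =>
    ((hasDerivAt_pow (a + 1) t).const_mul _).congr_deriv (by
      push_cast [Nat.add_sub_cancel]; field_simp)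
  have hm : MonotoneOn (fun t => lagG a k t - 3 / (4 * ((a : ℝ) + 1)) * lagPhi a k 0 * t ^ (a + 1))
      (Set.Icc 0 s) := by
    refine monotoneOn_of_hasDerivWithinAt_nonneg (convex_Icc _ _)
      (fun t _ => ((hasDerivAt_lagG a k t).sub (hpow t)).continuousAt.continuousWithinAt)
      (fun t _ => ((hasDerivAt_lagG a k t).sub (hpow t)).hasDerivWithinAt) (fun t ht => ?_)
    have ht := interior_subset ht
    have h1 := lagPhi_ge a k ht.1 (ht.2.trans hsN)
    have h2 := mul_le_mul_of_nonneg_left h1 (pow_nonneg ht.1 a)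
    linarith
  have h := hm ⟨le_rfl, hs⟩ ⟨hs, le_rfl⟩ hs
  simp only [ne_eq, Nat.add_eq_zero_iff, one_ne_zero, and_false, not_false_eq_true, zero_pow,
    mul_zero, sub_zero] at h
  have h0 : lagG a k 0 = 0 := by simp [lagG]
  linarith

/-- The range `X ≤ N^(-1/2)`. -/
lemma exists_lagF_ge_of_le_inv_sqrt (a : ℕ) : ∃ c > 0, ∀ k : ℕ, ∀ X : ℝ, 0 < X →
    X ≤ 1 / Real.sqrt (nuR a k) → c * lagPhi a k 0 ^ 2 * X ^ (4 * a + 9) ≤ lagF a k X := by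
  refine ⟨(1 / 2) ^ (4 * a + 9) * (3 / (4 * ((a : ℝ) + 1))) ^ 2, by positivity, fun k X hX hXN => ?_⟩
  have hN := two_le_nuR a k
  have hX2 : X ^ 2 ≤ 1 / nuR a k := by
    calc X ^ 2 ≤ (1 / Real.sqrt (nuR a k)) ^ 2 := by gcongr
      _ = _ := by rw [div_pow, Real.sq_sqrt (by linarith), one_pow]
  have hN2 : 1 / nuR a k ≤ 1 / 2 := by gcongr
  have h0 := lagPhi_zero_pos a k
  have hY : X / 2 * ((3 / (4 * ((a : ℝ) + 1)) * lagPhi a k 0 * (X / 2) ^ (2 * a + 2)) ^ 2) ≤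
      ∫ x in X / 2..X, lagG a k (x ^ 2) ^ 2 := by
    have := mul_integral_le_of_le (u := X / 2) (v := X) (by linarith) (continuous_lagG_sq a k)
      (continuous_const (y := (1 : ℝ))) (fun _ => zero_le_one)
      (m := (3 / (4 * ((a : ℝ) + 1)) * lagPhi a k 0 * (X / 2) ^ (2 * a + 2)) ^ 2) (fun x hx => ?_)
    · simp only [mul_one, intervalIntegral.integral_const, smul_eq_mul] at this
      linarith
    · have hx0 : 0 < x := by linarith [hx.1]
      have hxX : x ^ 2 ≤ X ^ 2 := by have := hx.2; gcongr
      have := lagG_ge a k (s := x ^ 2) (by positivity) (hxX.trans hX2)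
      gcongr
      refine le_trans ?_ this
      rw [← pow_mul]
      have e : 2 * (a + 1) = 2 * a + 2 := by ring
      rw [e]
      have := hx.1
      gcongr
  have hF := mul_integral_le_lagF a k (m := (X / 2) ^ 4) (u := X / 2) (v := X) (X := X)
    (by linarith) (by linarith) le_rfl (fun x hx => by
      have hx0 : 0 < x := by linarith [hx.1]
      have hxX : x ^ 2 ≤ X ^ 2 := by have := hx.2; gcongr
      refine le_trans ?_ (pow_four_le_sin_sq (by linarith))
      have := hx.1
      gcongr)
  refine le_trans (le_trans (le_of_eq ?_) (mul_le_mul_of_nonneg_left hY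
    (by positivity : 0 ≤ (X / 2) ^ 4))) hF
  ring

/-- Mean square lower bound for `lagG` on windows away from the turning point. -/
lemma exists_integral_lagG_sq_ge (a : ℕ) : ∃ K ≥ (1 : ℝ), ∃ c > 0, ∀ k : ℕ, ∀ x₁ x₂ : ℝ,
    K ≤ x₁ * Real.sqrt (nuR a k) → K ≤ (x₂ - x₁) * Real.sqrt (nuR a k) → 0 < x₂ →
    x₂ ^ 2 ≤ nuR a k / 2 →
    c * lagPhi a k 0 ^ 2 * (x₁ ^ (2 * a + 1) * (x₂ - x₁) / Real.sqrt (nuR a k) ^ (2 * a + 3)) ≤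
      ∫ x in x₁..x₂, lagG a k (x ^ 2) ^ 2 := by
  obtain ⟨c₁, hc₁, c₂, hc₂, hE⟩ := exists_oscEnergy_lagH_bounds a
  set β : ℝ := (a : ℝ) ^ 2 - 1 / 4 with hβ
  refine ⟨1 + 2 * |β| + 2 * (1 + 6 * c₂ / c₁), ?_, 4 * (c₁ ^ 2 / (34992 * c₂)), by positivity,
    fun k x₁ x₂ h1 h2 hx₂0 h3 => ?_⟩
  · have : 0 ≤ |β| := abs_nonneg β
    have : 0 ≤ 6 * c₂ / c₁ := by positivity
    linarith
  have hN := two_le_nuR a k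
  have hN0 := nuR_pos a k
  have hφ0 := lagPhi_zero_pos a k
  have hEpos := lagE_pos a k
  have hlE : lagE a k = lagPhi a k 0 ^ 2 / nuR a k ^ a := rfl
  set N := nuR a k with hNdef
  have hR0 : 0 < Real.sqrt N := Real.sqrt_pos.2 hN0
  have hRN : Real.sqrt N ^ 2 = N := Real.sq_sqrt hN0.le
  set R := Real.sqrt N with hR
  have hK1 : 0 ≤ 6 * c₂ / c₁ := by positivity
  have hβ0 : 0 ≤ |β| := abs_nonneg β
  have hx₁R : 1 + 2 * |β| ≤ x₁ * R := by linarith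
  have hx₁ : 0 < x₁ := by
    by_contra hneg
    have := mul_nonpos_of_nonpos_of_nonneg (not_lt.1 hneg) hR0.le
    linarith
  have h12 : x₁ < x₂ := by
    by_contra hneg
    have := mul_nonpos_of_nonpos_of_nonneg (by linarith : x₂ - x₁ ≤ 0) hR0.le
    linarith
  have hq : N / 2 ≤ N - x₂ ^ 2 := by linarith
  have hrl : R / 2 ≤ Real.sqrt (N - x₂ ^ 2) := by
    apply Real.le_sqrt_of_sq_le; rw [div_pow, hRN]; linarith
  have hr1 : 1 ≤ Real.sqrt (N - x₂ ^ 2) := by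
    apply Real.le_sqrt_of_sq_le; linarith
  have hru : Real.sqrt (N - x₂ ^ 2) ≤ R := Real.sqrt_le_sqrt (by linarith [sq_nonneg x₂])
  have hℓ : 1 + 6 * c₂ / c₁ ≤ (x₂ - x₁) * Real.sqrt (N - x₂ ^ 2) := by
    have : (x₂ - x₁) * (R / 2) ≤ (x₂ - x₁) * Real.sqrt (N - x₂ ^ 2) := by
      have : 0 ≤ x₂ - x₁ := by linarith
      gcongr
    linarith
  have key := integral_window_ge (N := N) (β := β) (c₁ := c₁) (c₂ := c₂) (e := lagE a k)
    (h := lagH a k) (h₁ := lagH₁ a k) (y := fun x => lagG a k (x ^ 2))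
    (w := fun x => 2 * lagW a x) (w₁ := 2 * lagW a x₁) hx₁ h12 (by linarith)
    (by linarith [sq_nonneg x₁]) (by
      rw [div_le_iff₀ (by positivity)]
      have : (1 + 2 * |β|) ^ 2 ≤ (x₁ * R) ^ 2 := by gcongr
      rw [mul_pow, hRN] at this
      have h4 : N / 2 * x₁ ^ 2 ≤ (N - x₂ ^ 2) * x₁ ^ 2 := by gcongr
      linarith [sq_nonneg (|β|)]) hc₁ hc₂ hEpos
    (by linarith) (by linarith)
    (fun t ht => hasDerivAt_lagH a k ht) (fun t ht => hasDerivAt_lagH₁ a k ht)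
    (fun x hx => ?_) (fun t ht => hasDerivAt_lagG_sq a k ht)
    (by have := lagW_pos a hx₁; positivity)
    (fun x hx => by
      have := lagW_mono a hx₁.le hx.1
      linarith)
  · refine le_trans ?_ key
    rw [mul_pow, lagW_sq a hx₁.le, mul_assoc _ (lagPhi a k 0 ^ 2), mul_assoc 4, mul_left_comm 4,
      hlE]
    have : 0 ≤ x₂ - x₁ := by linarith
    have e : 4 * (lagPhi a k 0 ^ 2 * (x₁ ^ (2 * a + 1) * (x₂ - x₁) / R ^ (2 * a + 3))) =
        2 ^ 2 * x₁ ^ (2 * a + 1) * (lagPhi a k 0 ^ 2 / N ^ a) * (x₂ - x₁) / R ^ 3 := by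
      rw [← hRN]; field_simp; ring
    rw [e]
    gcongr
  · have hx0 := hx₁.trans_le hx.1
    have hxx : x ^ 2 ≤ x₂ ^ 2 := by have := hx.2; gcongr
    refine hE k x ?_ (by linarith) ?_
    · rw [div_le_iff₀ hR0]
      have : x₁ * R ≤ x * R := by have := hx.1; gcongr
      linarith
    · have hs1 : 1 ≤ Real.sqrt (N - x ^ 2) := by
        apply Real.le_sqrt_of_sq_le; linarith
      have hxs : x ≤ Real.sqrt (N - x ^ 2) := Real.le_sqrt_of_sq_le (by linarith)
      exact hxs.trans (le_self_pow₀ hs1 (by norm_num))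

/-- The range `C N^(-1/2) ≤ X ≤ 1/2`. -/
lemma exists_lagF_ge_of_le_half (a : ℕ) : ∃ K ≥ (1 : ℝ), ∃ c > 0, ∀ k : ℕ, ∀ X : ℝ,
    K / Real.sqrt (nuR a k) ≤ X → X ≤ 1 / 2 →
    c * lagPhi a k 0 ^ 2 * (X ^ (2 * a + 6) / Real.sqrt (nuR a k) ^ (2 * a + 3)) ≤ lagF a k X := by
  obtain ⟨K, hK, c, hc, h⟩ := exists_integral_lagG_sq_ge a
  refine ⟨2 * K, by linarith, c * (1 / 2) ^ (2 * a + 6), by positivity, fun k X h1 h2 => ?_⟩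
  have hN := two_le_nuR a k
  have hR0 : 0 < Real.sqrt (nuR a k) := Real.sqrt_pos.2 (by linarith)
  have hX : 0 < X := lt_of_lt_of_le (by positivity) h1
  rw [div_le_iff₀ hR0] at h1
  have hX2 : X ^ 2 ≤ 1 / 2 := by nlinarith
  have key := h k (X / 2) X (by linarith) (by linarith) hX (by linarith)
  have hF := mul_integral_le_lagF a k (m := (X / 2) ^ 4) (u := X / 2) (v := X) (X := X)
    (by linarith) (by linarith) le_rfl (fun x hx => by
      have hx0 : 0 < x := by linarith [hx.1]
      have hxX : x ^ 2 ≤ X ^ 2 := by have := hx.2; gcongr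
      refine le_trans ?_ (pow_four_le_sin_sq (by linarith))
      have := hx.1
      gcongr)
  refine le_trans (le_trans (le_of_eq ?_) (mul_le_mul_of_nonneg_left key
    (by positivity : 0 ≤ (X / 2) ^ 4))) hF
  ring

lemma half_le_sin_sq {m : ℕ} {x : ℝ} (h1 : m * (Real.pi / 2) + Real.pi / 8 ≤ x ^ 2)
    (h2 : x ^ 2 ≤ m * (Real.pi / 2) + 3 * Real.pi / 8) : 1 / 2 ≤ Real.sin (2 * x ^ 2) ^ 2 := by
  have hc : Real.cos (2 * (2 * x ^ 2)) ≤ 0 := by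
    rw [← Real.cos_sub_nat_mul_two_pi _ m]
    apply Real.cos_nonpos_of_pi_div_two_le_of_le <;> linarith
  rw [Real.sin_sq_eq_half_sub]
  linarith

lemma nsmul_le_lagF (a k m₀ j : ℕ) {b : ℝ} (h : ∀ m, m₀ ≤ m → m < m₀ + j →
    b ≤ 1 / 2 * ∫ x in Real.sqrt (m * (Real.pi / 2) + Real.pi / 8)..
      Real.sqrt (m * (Real.pi / 2) + 3 * Real.pi / 8), lagG a k (x ^ 2) ^ 2) :
    j * b ≤ lagF a k (Real.sqrt ((m₀ + j : ℕ) * (Real.pi / 2))) := by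
  induction j with
  | zero =>
    rw [Nat.cast_zero, zero_mul]
    exact lagF_nonneg a k (Real.sqrt_nonneg _)
  | succ j ih =>
    have ih := ih fun m h1 h2 => h m h1 (by omega)
    have hb := h (m₀ + j) (by omega) (by omega)
    have hpi := Real.pi_pos
    set m := m₀ + j with hm
    set u := Real.sqrt (m * (Real.pi / 2) + Real.pi / 8) with hu
    set v := Real.sqrt (m * (Real.pi / 2) + 3 * Real.pi / 8) with hv
    have huv : u ≤ v := Real.sqrt_le_sqrt (by linarith)
    have hmu : Real.sqrt (m * (Real.pi / 2)) ≤ u := Real.sqrt_le_sqrt (by linarith)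
    have hvm : v ≤ Real.sqrt ((m₀ + (j + 1) : ℕ) * (Real.pi / 2)) := by
      apply Real.sqrt_le_sqrt
      rw [← add_assoc, ← hm]; push_cast; linarith
    have h1 := mul_integral_le_of_le (m := 1 / 2) huv continuous_sin_sq (continuous_lagG_sq a k)
      (fun x => sq_nonneg _) (fun x hx => by
        have hx0 : 0 ≤ x := (Real.sqrt_nonneg _).trans hx.1
        refine half_le_sin_sq (m := m) ?_ ?_
        · exact (Real.sqrt_le_left hx0).1 hx.1
        · exact (Real.le_sqrt hx0 (by positivity)).1 hx.2)
    have h2 : lagF a k u + ∫ x in u..v, Real.sin (2 * x ^ 2) ^ 2 * lagG a k (x ^ 2) ^ 2 =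
        lagF a k v :=
      intervalIntegral.integral_add_adjacent_intervals
        ((continuous_lagF_integrand a k).intervalIntegrable _ _)
        ((continuous_lagF_integrand a k).intervalIntegrable _ _)
    have h3 := lagF_mono a k (Real.sqrt_nonneg _) hmu
    have h4 := lagF_mono a k (Real.sqrt_nonneg _) hvm
    push_cast at h4 ⊢
    linarith

/-- The range `C ≤ X ≤ ε √N`. -/
lemma exists_lagF_ge_of_le_sqrt (a : ℕ) : ∃ ε > (0 : ℝ), ∃ c > 0, ∀ k : ℕ, ∀ X : ℝ,
    2 ≤ X → X ≤ ε * Real.sqrt (nuR a k) →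
    c * lagPhi a k 0 ^ 2 * (X ^ (2 * a + 2) / Real.sqrt (nuR a k) ^ (2 * a + 3)) ≤ lagF a k X := by
  obtain ⟨K, hK, c, hc, h⟩ := exists_integral_lagG_sq_ge a
  refine ⟨1 / (3 * K), by positivity, 1 / 8 * (1 / 2) * c * (1 / 2) ^ (2 * a + 1) * (1 / 3),
    by positivity, fun k X h1 h2 => ?_⟩
  have hN := two_le_nuR a k
  have hφ0 := lagPhi_zero_pos a k
  have hR0 : 0 < Real.sqrt (nuR a k) := Real.sqrt_pos.2 (by linarith)
  have hRN : Real.sqrt (nuR a k) ^ 2 = nuR a k := Real.sq_sqrt (by linarith)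
  set R := Real.sqrt (nuR a k)
  rw [div_mul_eq_mul_div, one_mul, le_div_iff₀ (by positivity)] at h2
  have hX : 0 < X := by linarith
  have hpi3 := Real.pi_gt_three
  have hpi4 := Real.pi_le_four
  have hpi := Real.pi_pos
  have hKX : 3 * X ≤ R := by nlinarith
  set j := ⌊X ^ 2 / Real.pi⌋₊ with hj
  have hj1 : (j : ℝ) ≤ X ^ 2 / Real.pi := Nat.floor_le (by positivity)
  have hj2 : X ^ 2 / Real.pi < j + 1 := Nat.lt_floor_add_one _
  have hj3 : 1 ≤ X ^ 2 / Real.pi := by rw [le_div_iff₀ hpi]; nlinarith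
  have hj4 : (1 : ℝ) ≤ j := by
    have : 1 ≤ j := Nat.le_floor (by exact_mod_cast hj3)
    exact_mod_cast this
  have hj5 : X ^ 2 / 8 ≤ j := by
    have : X ^ 2 / 4 ≤ X ^ 2 / Real.pi := by gcongr
    linarith
  rw [le_div_iff₀ hpi] at hj1
  have hj6 : X ^ 2 / 4 ≤ j * (Real.pi / 2) := by
    rw [div_lt_iff₀ hpi] at hj2
    nlinarith
  have hb := nsmul_le_lagF a k j j (b := 1 / 2 * (c * lagPhi a k 0 ^ 2 *
      ((X / 2) ^ (2 * a + 1) * (1 / (3 * X)) / R ^ (2 * a + 3)))) (fun m hm1 hm2 => by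
    have hm1' : (j : ℝ) ≤ m := by exact_mod_cast hm1
    have hm2' : (m : ℝ) + 1 ≤ j + j := by exact_mod_cast hm2
    set u := Real.sqrt (m * (Real.pi / 2) + Real.pi / 8) with hu
    set v := Real.sqrt (m * (Real.pi / 2) + 3 * Real.pi / 8) with hv
    have hu2 : u ^ 2 = m * (Real.pi / 2) + Real.pi / 8 := Real.sq_sqrt (by positivity)
    have hv2 : v ^ 2 = m * (Real.pi / 2) + 3 * Real.pi / 8 := Real.sq_sqrt (by positivity)
    have hu0 : 0 < u := Real.sqrt_pos.2 (by positivity)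
    have hv0 : 0 < v := Real.sqrt_pos.2 (by positivity)
    have hvX2 : v ^ 2 ≤ X ^ 2 := by rw [hv2]; nlinarith
    have hvX : v ≤ X := abs_le_of_sq_le_sq' hvX2 hX.le |>.2
    have huv : u ≤ v := Real.sqrt_le_sqrt (by linarith)
    have huX : X / 2 ≤ u := by
      refine abs_le_of_sq_le_sq' ?_ hu0.le |>.2
      rw [hu2]; nlinarith
    have hℓ : 1 / (3 * X) ≤ v - u := by
      rw [div_le_iff₀ (by positivity)]
      have : (v - u) * (v + u) = Real.pi / 4 := by linear_combination hv2 - hu2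
      have : (v - u) * (v + u) ≤ (v - u) * (2 * X) := by
        have : 0 ≤ v - u := by linarith
        gcongr
        linarith
      linarith
    have key := h k u v (by nlinarith) (by
      calc K ≤ 1 / (3 * X) * R := by
            rw [div_mul_eq_mul_div, one_mul, le_div_iff₀ (by positivity)]; linarith
        _ ≤ _ := by gcongr) hv0 (by
      have : (3 * X) ^ 2 ≤ R ^ 2 := by gcongr
      rw [hRN] at this
      nlinarith)
    refine mul_le_mul_of_nonneg_left (le_trans ?_ key) (by norm_num)
    gcongr)
  have hmono := lagF_mono a k (x := Real.sqrt ((j + j : ℕ) * (Real.pi / 2))) (X := X)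
    (Real.sqrt_nonneg _) (by
      rw [Real.sqrt_le_left hX.le]
      push_cast
      linarith)
  refine le_trans ?_ (hb.trans hmono)
  refine le_trans (le_of_eq ?_) (mul_le_mul_of_nonneg_right hj5 (by positivity))
  field_simp
  ring

lemma exists_sin_four_mul_eq_zero {t : ℝ} (ht : 0 ≤ t) :
    ∃ u, t - 1 ≤ u ∧ u ≤ t ∧ Real.sin (4 * u) = 0 := by
  have hpi := Real.pi_pos
  have hpi4 := Real.pi_le_four
  refine ⟨⌊t / (Real.pi / 4)⌋₊ * (Real.pi / 4), ?_, ?_, ?_⟩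
  · have := Nat.lt_floor_add_one (t / (Real.pi / 4))
    rw [div_lt_iff₀ (by positivity)] at this
    linarith
  · have := Nat.floor_le (a := t / (Real.pi / 4)) (by positivity)
    rwa [le_div_iff₀ (by positivity)] at this
  · rw [show 4 * (⌊t / (Real.pi / 4)⌋₊ * (Real.pi / 4)) = ⌊t / (Real.pi / 4)⌋₊ * Real.pi by ring]
    exact Real.sin_nat_mul_pi _

/-- Square roots of nearby zeros of `sin (4 u)` just inside a prescribed interval. -/
lemma exists_window_sqrt {A B : ℝ} (hA : 1 ≤ A) (hAB : A + 2 < B) :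
    ∃ x₁ x₂ : ℝ, 1 ≤ x₁ ∧ x₁ < x₂ ∧ A ≤ x₁ ^ 2 ∧ x₁ ^ 2 ≤ A + 1 ∧ B - 1 ≤ x₂ ^ 2 ∧ x₂ ^ 2 ≤ B ∧
      Real.sin (4 * x₁ ^ 2) = 0 ∧ Real.sin (4 * x₂ ^ 2) = 0 := by
  obtain ⟨u, hu1, hu2, hu3⟩ := exists_sin_four_mul_eq_zero (t := A + 1) (by linarith)
  obtain ⟨v, hv1, hv2, hv3⟩ := exists_sin_four_mul_eq_zero (t := B) (by linarith)
  have hus : Real.sqrt u ^ 2 = u := Real.sq_sqrt (by linarith)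
  have hvs : Real.sqrt v ^ 2 = v := Real.sq_sqrt (by linarith)
  refine ⟨Real.sqrt u, Real.sqrt v, ?_, Real.sqrt_lt_sqrt (by linarith) (by linarith), ?_⟩
  · rw [Real.one_le_sqrt]; linarith
  · rw [hus, hvs]
    exact ⟨by linarith, hu2, hv1, hv2, hu3, hv3⟩

/-- The oscillating factor `sin²` averages to a positive constant against slowly varying
functions. -/
lemma integral_sin_sq_mul_ge {y y' : ℝ → ℝ} {m x₁ x₂ : ℝ} (hx₁ : 1 ≤ x₁) (h12 : x₁ ≤ x₂)
    (h1 : Real.sin (4 * x₁ ^ 2) = 0) (h2 : Real.sin (4 * x₂ ^ 2) = 0)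
    (hy : ∀ t > 0, HasDerivAt y (y' t) t) (hm : ∀ x ∈ Set.Icc x₁ x₂, y' x ^ 2 ≤ m * x ^ 2) :
    3 / 8 * (∫ x in x₁..x₂, y x ^ 2) - (x₂ - x₁) * m / 16 ≤
      ∫ x in x₁..x₂, Real.sin (2 * x ^ 2) ^ 2 * y x ^ 2 := by
  have hpos : ∀ x ∈ Set.Icc x₁ x₂, 0 < x := fun x hx => by linarith [hx.1]
  have hcont : ContinuousOn y (Set.Icc x₁ x₂) := fun x hx =>
    (hy x (hpos x hx)).continuousAt.continuousWithinAt
  have key := integral_le_integral_of_deriv_ge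
    (F := fun x => Real.sin (4 * x ^ 2) / (16 * x) * y x ^ 2)
    (F' := fun x => ((Real.cos (4 * x ^ 2) - Real.sin (4 * x ^ 2) / (8 * x ^ 2)) * y x ^ 2 +
      Real.sin (4 * x ^ 2) / (8 * x) * (2 * y x * y' x)) / 2)
    (f := fun x => Real.sin (2 * x ^ 2) ^ 2 * y x ^ 2 + m / 16)
    (g := fun x => 3 / 8 * y x ^ 2) h12 (fun x hx => by
      have hx0 := hpos x hx
      have hs : HasDerivAt (fun x : ℝ => Real.sin (4 * x ^ 2)) (Real.cos (4 * x ^ 2) * (8 * x)) x :=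
        (((hasDerivAt_pow 2 x).const_mul 4).sin).congr_deriv (by push_cast; ring)
      refine ((hs.div ((hasDerivAt_id x).const_mul 16) (by simpa using hx0.ne')).mul
        ((hy x hx0).pow 2)).congr_deriv ?_
      simp only [id, Pi.div_apply, Pi.pow_apply]
      field_simp
      ring)
    (by simp [h1, h2]) (by fun_prop) (by fun_prop) (fun x hx => by
      have hx0 := hpos x hx
      have hx1 : 1 ≤ x := hx₁.trans hx.1
      have hsin := Real.sin_sq_eq_half_sub (2 * x ^ 2)
      rw [show 2 * (2 * x ^ 2) = 4 * x ^ 2 by ring] at hsin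
      rw [hsin]
      have hs1 := Real.abs_sin_le_one (4 * x ^ 2)
      set σ := Real.sin (4 * x ^ 2)
      have b1 : |σ / (8 * x ^ 2)| ≤ 1 / 8 := by
        rw [abs_div, abs_of_pos (by positivity : 0 < 8 * x ^ 2), div_le_div_iff₀ (by positivity)
          (by norm_num)]
        nlinarith
      have b2 : |σ / (8 * x) * (2 * y x * y' x)| ≤ (y x ^ 2 + m) / 8 := by
        have e : σ / (8 * x) * (2 * y x * y' x) = σ * (y x * (y' x / x)) / 4 := by
          field_simp; ring
        have hz : (y' x / x) ^ 2 ≤ m := by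
          rw [div_pow, div_le_iff₀ (by positivity)]; exact hm x hx
        rw [e, abs_div, abs_mul, abs_of_pos (by norm_num : (0 : ℝ) < 4)]
        set z := y' x / x
        have hyz : |y x * z| ≤ (y x ^ 2 + m) / 2 := by
          rw [abs_le]
          constructor <;> nlinarith [sq_nonneg (y x + z), sq_nonneg (y x - z)]
        have : |σ| * |y x * z| ≤ 1 * ((y x ^ 2 + m) / 2) := by gcongr
        linarith
      have b3 := mul_le_mul_of_nonneg_right (abs_le.1 b1).2 (sq_nonneg (y x))
      have b4 := (abs_le.1 b2).1
      linarith)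
  rw [intervalIntegral.integral_const_mul, intervalIntegral.integral_add
    (ContinuousOn.intervalIntegrable_of_Icc h12 (by fun_prop)) (by simp),
    intervalIntegral.integral_const, smul_eq_mul] at key
  linarith

lemma pow_three_le_of_sq {r D N : ℝ} (hr : 0 ≤ r) (hr2 : D ≤ r ^ 2) (hD : 0 ≤ D)
    (h : N ≤ D ^ 3) : Real.sqrt N ≤ r ^ 3 := by
  apply Real.sqrt_le_left (by positivity) |>.2
  calc N ≤ D ^ 3 := h
    _ ≤ (r ^ 2) ^ 3 := by gcongr
    _ = _ := by ring

set_option maxHeartbeats 1000000 in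
/-- The range just below the turning point. -/
lemma exists_lagF_ge_of_sub (a : ℕ) : ∃ ε > (0 : ℝ), ∃ K ≥ (1 : ℝ), ∃ c > 0, ∀ k : ℕ, ∀ D : ℝ,
    K ≤ D → K * nuR a k ≤ D ^ 3 → D ≤ ε * nuR a k →
    c * lagPhi a k 0 ^ 2 / Real.sqrt D ≤ lagF a k (Real.sqrt (nuR a k - D)) := by
  obtain ⟨c₁, hc₁, c₂, hc₂, hE⟩ := exists_oscEnergy_lagH_bounds a
  set β : ℝ := (a : ℝ) ^ 2 - 1 / 4 with hβ
  set b : ℝ := c₁ ^ 2 / (34992 * c₂) with hb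
  have hb0 : 0 < b := by positivity
  set b' : ℝ := b * (1 / 2) ^ (a + 2) with hb'
  have hb'0 : 0 < b' := by positivity
  have hβ0 : 0 ≤ |β| := abs_nonneg β
  have hK1 : 0 ≤ 6 * c₂ / c₁ := by positivity
  refine ⟨min (1 / 4) (b' / (8 * c₂)), by positivity, 8 + |β| + 16 * (1 + 6 * c₂ / c₁) ^ 2, ?_,
    b' / 4, by positivity, fun k D h1 h2 h3 => ?_⟩
  · have : 0 ≤ (1 + 6 * c₂ / c₁) ^ 2 := by positivity
    linarith
  have hN := two_le_nuR a k
  have hN0 := nuR_pos a k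
  have hφ0 := lagPhi_zero_pos a k
  have hEpos := lagE_pos a k
  have hlE : lagE a k = lagPhi a k 0 ^ 2 / nuR a k ^ a := rfl
  set N := nuR a k with hNdef
  set φ₀ := lagPhi a k 0
  have hR0 : 0 < Real.sqrt N := Real.sqrt_pos.2 hN0
  have hRN : Real.sqrt N ^ 2 = N := Real.sq_sqrt hN0.le
  set R := Real.sqrt N with hR
  have hsq0 : 0 ≤ (1 + 6 * c₂ / c₁) ^ 2 := by positivity
  have hD8 : 8 ≤ D := by linarith
  have hD4 : D ≤ N / 4 := by
    have : min (1 / 4) (b' / (8 * c₂)) * N ≤ 1 / 4 * N := by gcongr; exact min_le_left _ _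
    linarith
  have hDε : D * (8 * c₂) ≤ b' * N := by
    have : min (1 / 4) (b' / (8 * c₂)) * N ≤ b' / (8 * c₂) * N := by gcongr; exact min_le_right _ _
    have h4 := h3.trans this
    rw [div_mul_eq_mul_div, le_div_iff₀ (by positivity)] at h4
    exact h4
  have hND : N ≤ D ^ 3 := by
    refine le_trans (le_mul_of_one_le_left hN0.le ?_) h2
    linarith
  have hd0 : 0 < Real.sqrt D := Real.sqrt_pos.2 (by linarith)
  have hd2 : Real.sqrt D ^ 2 = D := Real.sq_sqrt (by linarith)
  set d := Real.sqrt D with hd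
  obtain ⟨x₁, x₂, hx₁1, h12, hl1, hu1, hl2, hu2, hs1, hs2⟩ :=
    exists_window_sqrt (A := N - 2 * D) (B := N - D) (by linarith) (by linarith)
  have hx₁ : 0 < x₁ := by linarith
  have hx₂ : 0 < x₂ := by linarith
  have hx₂R : x₂ ≤ R := Real.le_sqrt_of_sq_le (by linarith)
  have hrl : d ≤ Real.sqrt (N - x₂ ^ 2) := Real.sqrt_le_sqrt (by linarith)
  have hr2 : Real.sqrt (N - x₂ ^ 2) ^ 2 = N - x₂ ^ 2 := Real.sq_sqrt (by linarith)
  have hru : Real.sqrt (N - x₂ ^ 2) ≤ 5 / 4 * d := by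
    apply Real.sqrt_le_left (by positivity) |>.2
    rw [mul_pow, hd2]; linarith
  set r := Real.sqrt (N - x₂ ^ 2) with hr
  have hr0 : 0 < r := hd0.trans_le hrl
  have hprod : (x₂ - x₁) * (x₂ + x₁) = x₂ ^ 2 - x₁ ^ 2 := by ring
  have hℓ0 : 0 ≤ x₂ - x₁ := by linarith
  have hℓl : D / 4 ≤ (x₂ - x₁) * R := by
    have : (x₂ - x₁) * (x₂ + x₁) ≤ (x₂ - x₁) * (2 * R) := by gcongr; linarith
    linarith
  have hsum : R ≤ x₂ + x₁ := by
    refine abs_le_of_sq_le_sq' ?_ (by linarith) |>.2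
    rw [hRN]
    have : 0 < x₂ * x₁ := by positivity
    linarith
  have hℓu : (x₂ - x₁) * R ≤ D := by
    have : (x₂ - x₁) * R ≤ (x₂ - x₁) * (x₂ + x₁) := by gcongr
    linarith
  have hℓr : 1 + 6 * c₂ / c₁ ≤ (x₂ - x₁) * r := by
    have e1 : (4 * (1 + 6 * c₂ / c₁)) ^ 2 * N ≤ D ^ 3 := by
      refine le_trans ?_ h2
      gcongr
      linarith
    have e2 : 4 * (1 + 6 * c₂ / c₁) * R ≤ D * d := by
      refine abs_le_of_sq_le_sq' ?_ (by positivity) |>.2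
      rw [mul_pow _ R, mul_pow _ d, hRN, hd2]
      linarith
    have e3 : D / 4 * d ≤ (x₂ - x₁) * R * r := by gcongr
    refine le_of_mul_le_mul_left ?_ hR0
    linarith
  have hxx : ∀ x ∈ Set.Icc x₁ x₂, 0 < x ∧ x₁ ^ 2 ≤ x ^ 2 ∧ x ^ 2 ≤ x₂ ^ 2 := fun x hx => by
    have h1 := hx.1
    have h2 := hx.2
    have : 0 < x := by linarith
    exact ⟨this, by gcongr, by gcongr⟩
  have hEx : ∀ x ∈ Set.Icc x₁ x₂, c₁ * lagE a k ≤ oscEnergy N (lagH a k) (lagH₁ a k) x ∧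
      oscEnergy N (lagH a k) (lagH₁ a k) x ≤ c₂ * lagE a k := fun x hx => by
    obtain ⟨hx0, hxl, hxu⟩ := hxx x hx
    refine hE k x ?_ (by linarith) ?_
    · have : 1 ≤ R := by rw [hR, Real.one_le_sqrt]; linarith
      refine le_trans ?_ (hx₁1.trans hx.1)
      rw [div_le_one hR0]; exact this
    · refine (hx.2.trans hx₂R).trans ?_
      refine pow_three_le_of_sq (D := D) (Real.sqrt_nonneg _) ?_ (by linarith) hND
      rw [Real.sq_sqrt (by linarith)]; linarith
  have key := integral_window_ge (N := N) (β := β) (c₁ := c₁) (c₂ := c₂) (e := lagE a k)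
    (h := lagH a k) (h₁ := lagH₁ a k) (y := fun x => lagG a k (x ^ 2))
    (w := fun x => 2 * lagW a x) (w₁ := 2 * lagW a x₁) hx₁ h12 (by linarith)
    (by linarith) (by
      rw [div_le_iff₀ (by positivity)]
      have h5 : |β| ≤ N - x₂ ^ 2 := by linarith
      refine h5.trans (le_mul_of_one_le_right (by linarith) (one_le_pow₀ hx₁1))) hc₁ hc₂ hEpos (by linarith) (by linarith)
    (fun t ht => hasDerivAt_lagH a k ht) (fun t ht => hasDerivAt_lagH₁ a k ht)
    hEx (fun t ht => hasDerivAt_lagG_sq a k ht)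
    (by have := lagW_pos a hx₁; positivity)
    (fun x hx => by
      have := lagW_mono a hx₁.le hx.1
      linarith)
  have hY : b' * φ₀ ^ 2 / d ≤ ∫ x in x₁..x₂, lagG a k (x ^ 2) ^ 2 := by
    refine le_trans ?_ key
    have hxR : R ^ (2 * a + 1) * (1 / 2) ^ (a + 1) ≤ x₁ ^ (2 * a + 1) := by
      have g1 : (1 / 2) * R ≤ x₁ := by
        refine abs_le_of_sq_le_sq' ?_ (by linarith) |>.2
        rw [mul_pow, hRN]; linarith
      have g2 : R ^ 2 * (1 / 2) ≤ x₁ ^ 2 := by rw [hRN]; linarith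
      calc R ^ (2 * a + 1) * (1 / 2) ^ (a + 1) = (R ^ 2 * (1 / 2)) ^ a * (1 / 2 * R) := by
            rw [mul_pow]; ring
        _ ≤ (x₁ ^ 2) ^ a * x₁ := by gcongr
        _ = _ := by ring
    have hr3 : r ^ 3 ≤ 2 * d ^ 3 := by
      calc r ^ 3 ≤ (5 / 4 * d) ^ 3 := by gcongr
        _ ≤ _ := by rw [mul_pow]; gcongr; norm_num
    rw [mul_pow, lagW_sq a hx₁.le, hlE]
    calc b' * φ₀ ^ 2 / d = b * (2 ^ 2 * (R ^ (2 * a + 1) * (1 / 2) ^ (a + 1)) *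
          (φ₀ ^ 2 / N ^ a) * (D / 4 / R) / (2 * d ^ 3)) := by
          rw [hb', ← hRN, ← hd2]; field_simp; ring
      _ ≤ _ := by
          gcongr
          rw [div_le_iff₀ hR0]; exact hℓl
  have hsin := integral_sin_sq_mul_ge (y := fun x => lagG a k (x ^ 2))
    (m := 8 * c₂ * φ₀ ^ 2 * R / (N * d)) hx₁1 h12.le hs1 hs2
    (fun t ht => hasDerivAt_lagG_sq a k ht) (fun x hx => by
      obtain ⟨hx0, hxl, hxu⟩ := hxx x hx
      have hsd : d ≤ Real.sqrt (N - x ^ 2) := Real.sqrt_le_sqrt (by linarith)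
      have hEu := (hEx x hx).2
      rw [oscEnergy] at hEu
      set s := Real.sqrt (N - x ^ 2)
      have hs0 : 0 < s := hd0.trans_le hsd
      have hp : 0 ≤ lagH₁ a k x ^ 2 / s := by positivity
      have hH : lagH a k x ^ 2 ≤ c₂ * lagE a k / d := by
        rw [le_div_iff₀ hd0]
        calc lagH a k x ^ 2 * d ≤ lagH a k x ^ 2 * s := by gcongr
          _ ≤ _ := by linarith
      have hxR : x ^ (2 * a + 1) ≤ R ^ (2 * a + 1) := by
        have := hx.2.trans hx₂R
        gcongr
      rw [mul_pow, mul_pow, lagW_sq a hx0.le]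
      calc 2 ^ 2 * x ^ (2 * a + 1) * lagH a k x ^ 2 ≤
            2 ^ 2 * R ^ (2 * a + 1) * (c₂ * lagE a k / d) := by gcongr
        _ = 8 * c₂ * φ₀ ^ 2 * R / (N * d) * (N / 2) := by
            rw [hlE, ← hRN]; field_simp; ring
        _ ≤ _ := by gcongr; linarith)
  have hF := integral_le_lagF a k (x := x₁) (y := x₂) (X := Real.sqrt (N - D)) (by linarith) h12.le
    (Real.le_sqrt_of_sq_le hu2)
  have hm : (x₂ - x₁) * (8 * c₂ * φ₀ ^ 2 * R / (N * d)) ≤ b' * φ₀ ^ 2 / d := by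
    calc (x₂ - x₁) * (8 * c₂ * φ₀ ^ 2 * R / (N * d)) =
          (x₂ - x₁) * R * (8 * c₂) * (φ₀ ^ 2 / (N * d)) := by ring
      _ ≤ D * (8 * c₂) * (φ₀ ^ 2 / (N * d)) := by gcongr
      _ ≤ b' * N * (φ₀ ^ 2 / (N * d)) := by gcongr
      _ = _ := by field_simp
  have hnn : 0 ≤ b' * φ₀ ^ 2 / d := by positivity
  have e : b' / 4 * φ₀ ^ 2 / d = b' * φ₀ ^ 2 / d / 4 := by ring
  rw [e]
  linarith

lemma antitoneOn_lagP_energy (a k : ℕ) {u : ℝ} (hu : 0 ≤ u)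
    (h : (2 * a + 1) * (nuR a k - u) ≤ u) :
    AntitoneOn (fun s => (nuR a k - s) / 4 * s ^ (2 * a + 1) * lagPhi a k s ^ 2 + lagP a k s ^ 2)
      (Set.Ici u) := by
  have hd : ∀ s, HasDerivAt
      (fun s => (nuR a k - s) / 4 * s ^ (2 * a + 1) * lagPhi a k s ^ 2 + lagP a k s ^ 2)
      (s ^ (2 * a) * lagPhi a k s ^ 2 * (((2 * a + 1) * (nuR a k - s) - s) / 4)) s := fun s => by
    refine ((((((hasDerivAt_id s).const_sub (nuR a k)).div_const 4).mul
      (hasDerivAt_pow (2 * a + 1) s)).mul ((hasDerivAt_lagPhi a k s).pow 2)).add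
      ((hasDerivAt_lagP a k s).pow 2)).congr_deriv ?_
    simp only [Nat.add_sub_cancel, lagP, id, Pi.pow_apply, Pi.mul_apply]
    push_cast
    ring
  refine antitoneOn_of_hasDerivWithinAt_nonpos (convex_Ici _)
    (fun s _ => (hd s).continuousAt.continuousWithinAt) (fun s _ => (hd s).hasDerivWithinAt)
    (fun s hs => ?_)
  rw [interior_Ici, Set.mem_Ioi] at hs
  refine mul_nonpos_of_nonneg_of_nonpos ?_ ?_
  · have : 0 ≤ s := by linarith
    positivity
  · have : (2 * a + 1) * (nuR a k - s) ≤ (2 * a + 1) * (nuR a k - u) := by gcongr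
    linarith

/-- The size of `lagP` at the turning point. -/
lemma exists_lagP_nuR_sq_le (a : ℕ) : ∃ C > (0 : ℝ), ∀ k : ℕ, ∀ δ : ℝ, 2 * a + 3 ≤ δ →
    δ ^ 3 = nuR a k → lagP a k (nuR a k) ^ 2 ≤ C * lagPhi a k 0 ^ 2 * δ ^ 2 := by
  obtain ⟨c₁, hc₁, c₂, hc₂, hE⟩ := exists_oscEnergy_lagH_bounds a
  refine ⟨5 / 4 * c₂, by positivity, fun k δ hδ hN => ?_⟩
  have ha : (0 : ℝ) ≤ a := Nat.cast_nonneg a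
  have hδ0 : 0 < δ := by linarith
  have hδδ : (2 * a + 3) * δ ≤ δ ^ 2 := by rw [pow_two]; gcongr
  have hδ2 : 2 * (a : ℝ) + 3 ≤ δ ^ 2 := by nlinarith
  have hδ3 : (2 * a + 3) * δ ≤ δ ^ 3 := by
    calc (2 * a + 3) * δ ≤ δ ^ 2 * δ := by gcongr
      _ = _ := by ring
  have haδ : 0 ≤ a * δ := by positivity
  set N := nuR a k with hNdef
  set φ₀ := lagPhi a k 0
  have hN0 : 0 < N := nuR_pos a k
  set r := Real.sqrt δ with hr
  have hr0 : 0 < r := Real.sqrt_pos.2 hδ0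
  have hr2 : r ^ 2 = δ := Real.sq_sqrt hδ0.le
  have hR : Real.sqrt N = r ^ 3 := by
    rw [← hN, ← hr2, show (r ^ 2) ^ 3 = (r ^ 3) ^ 2 by ring, Real.sqrt_sq (by positivity)]
  set x := Real.sqrt (N - δ) with hx
  have hx2 : x ^ 2 = N - δ := Real.sq_sqrt (by linarith)
  have hx0 : 0 < x := Real.sqrt_pos.2 (by linarith)
  have hx1 : 1 ≤ x := by rw [hx, Real.one_le_sqrt]; linarith
  have hxR : x ≤ r ^ 3 := by rw [← hR]; exact Real.sqrt_le_sqrt (by linarith)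
  have hrx : Real.sqrt (N - x ^ 2) = r := by rw [hx2, hr]; congr 1; ring
  have hE2 := (hE k x (by
    rw [hR]
    refine le_trans ?_ hx1
    rw [div_le_one (by positivity)]
    exact hx1.trans hxR) (by linarith) (by rw [hrx]; exact hxR)).2
  rw [oscEnergy, hrx] at hE2
  have hlE : lagE a k = φ₀ ^ 2 / N ^ a := rfl
  have hanti := antitoneOn_lagP_energy a k (u := N - δ) (by linarith) (by linarith)
    Set.self_mem_Ici (show N - δ ≤ N by linarith) (by linarith)
  simp only [← hNdef, sub_self, zero_div, zero_mul, zero_add] at hanti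
  have hp1 : 0 ≤ lagH₁ a k x ^ 2 / r := by positivity
  have hp2 : 0 ≤ r * lagH a k x ^ 2 := by positivity
  have hH : lagH a k x ^ 2 ≤ c₂ * lagE a k / r := by rw [le_div_iff₀ hr0]; linarith
  have hH1 : lagH₁ a k x ^ 2 ≤ c₂ * lagE a k * r := by rw [← div_le_iff₀ hr0]; linarith
  have hw : x ^ (2 * a + 1) ≤ N ^ a * r ^ 3 := by
    calc x ^ (2 * a + 1) = (x ^ 2) ^ a * x := by ring
      _ ≤ N ^ a * r ^ 3 := by gcongr; linarith
  have hw2 := lagW_sq a hx0.le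
  have hNa : 0 < N ^ a := by positivity
  have t1 : (N - (N - δ)) / 4 * (N - δ) ^ (2 * a + 1) * lagPhi a k (N - δ) ^ 2 ≤
      1 / 4 * c₂ * φ₀ ^ 2 * δ ^ 2 := by
    have e : (N - (N - δ)) / 4 * (N - δ) ^ (2 * a + 1) * lagPhi a k (N - δ) ^ 2 =
        δ / 4 * x ^ (2 * a + 1) * lagH a k x ^ 2 := by
      rw [lagH, mul_pow, hw2, ← hx2, show N - x ^ 2 = δ by linarith]; ring
    rw [e]
    calc δ / 4 * x ^ (2 * a + 1) * lagH a k x ^ 2 ≤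
          δ / 4 * (N ^ a * r ^ 3) * (c₂ * lagE a k / r) := by gcongr
      _ = _ := by rw [hlE, ← hr2]; field_simp
  have t2 : lagP a k (N - δ) ^ 2 ≤ c₂ * φ₀ ^ 2 * δ ^ 2 := by
    have e : lagP a k (N - δ) = lagW a x * (lagH₁ a k x - (a + 1 / 2) * lagH a k x / x) / 2 := by
      have : lagW a x * (lagH₁ a k x - (a + 1 / 2) * lagH a k x / x) / 2 =
          lagW a x ^ 2 * (x * lagPhi₁ a k (x ^ 2)) := by
        rw [lagH, lagH₁]; field_simp; ring
      rw [this, lagP, hw2, ← hx2]; ring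
    have hγ : ((a + 1 / 2) * lagH a k x / x) ^ 2 ≤ c₂ * lagE a k * r := by
      have hγ2 : ((a : ℝ) + 1 / 2) ^ 2 ≤ r ^ 2 * x ^ 2 := by
        calc ((a : ℝ) + 1 / 2) ^ 2 ≤ δ ^ 2 := by gcongr; linarith
          _ = δ * δ := by ring
          _ ≤ r ^ 2 * x ^ 2 := by rw [hr2, hx2]; gcongr; linarith
      have hEpos := lagE_pos a k
      rw [div_pow, mul_pow, div_le_iff₀ (by positivity)]
      calc ((a : ℝ) + 1 / 2) ^ 2 * lagH a k x ^ 2 ≤ (r ^ 2 * x ^ 2) * (c₂ * lagE a k / r) := by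
            gcongr
        _ = _ := by field_simp
    have hsq : (lagH₁ a k x - (a + 1 / 2) * lagH a k x / x) ^ 2 ≤ 4 * (c₂ * lagE a k * r) := by
      have := sq_nonneg (lagH₁ a k x + (a + 1 / 2) * lagH a k x / x)
      linarith
    rw [e, div_pow, mul_pow, hw2]
    have hEpos := lagE_pos a k
    calc x ^ (2 * a + 1) * (lagH₁ a k x - (a + 1 / 2) * lagH a k x / x) ^ 2 / 2 ^ 2 ≤
          (N ^ a * r ^ 3) * (4 * (c₂ * lagE a k * r)) / 2 ^ 2 := by gcongr
      _ = _ := by rw [hlE, ← hr2]; field_simp; ring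
  linarith

lemma tendsto_lagP_mul_lagPhi (a k : ℕ) :
    Filter.Tendsto (fun s => lagP a k s * lagPhi a k s) Filter.atTop (nhds 0) := by
  have h := Polynomial.tendsto_div_exp_atTop (Polynomial.X ^ (a + 1) *
    (Polynomial.derivative (lagPoly a k) - Polynomial.C (1 / 2) * lagPoly a k) * lagPoly a k)
  refine h.congr fun s => ?_
  have he : Real.exp s * (Real.exp (-s / 2) * Real.exp (-s / 2)) = 1 := by
    rw [← Real.exp_add, ← Real.exp_add]; simp
  rw [lagP, lagPhi, lagPhi₁, div_eq_iff (Real.exp_pos s).ne']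
  simp only [Polynomial.eval_mul, Polynomial.eval_pow, Polynomial.eval_X, Polynomial.eval_sub,
    Polynomial.eval_C]
  linear_combination (-(s ^ (a + 1) * (Polynomial.eval s (Polynomial.derivative (lagPoly a k)) -
    1 / 2 * Polynomial.eval s (lagPoly a k)) * Polynomial.eval s (lagPoly a k))) * he

lemma lagP_mul_lagPhi_nonpos (a k : ℕ) {s : ℝ} (hs : nuR a k ≤ s) :
    lagP a k s * lagPhi a k s ≤ 0 := by
  have hN := nuR_pos a k
  have hm : MonotoneOn (fun s => lagP a k s * lagPhi a k s) (Set.Ici (nuR a k)) := by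
    refine monotoneOn_of_hasDerivWithinAt_nonneg (convex_Ici _)
      (fun t _ => ((hasDerivAt_lagP a k t).mul
        (hasDerivAt_lagPhi a k t)).continuousAt.continuousWithinAt)
      (fun t _ => ((hasDerivAt_lagP a k t).mul (hasDerivAt_lagPhi a k t)).hasDerivWithinAt)
      (fun t ht => ?_)
    rw [interior_Ici, Set.mem_Ioi] at ht
    have e : -(t ^ a * ((nuR a k - t) / 4) * lagPhi a k t) * lagPhi a k t +
        lagP a k t * lagPhi₁ a k t =
        t ^ a * ((t - nuR a k) / 4) * lagPhi a k t ^ 2 + t ^ (a + 1) * lagPhi₁ a k t ^ 2 := by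
      rw [lagP]; ring
    rw [e]
    have h0 : 0 < t := by linarith
    have h1 : 0 < t - nuR a k := by linarith
    positivity
  refine ge_of_tendsto (tendsto_lagP_mul_lagPhi a k) ?_
  filter_upwards [Filter.eventually_ge_atTop s] with t ht
  exact hm hs (hs.trans ht) ht

lemma abs_lagP_le (a k : ℕ) {s : ℝ} (hs : nuR a k ≤ s) :
    |lagP a k s| ≤ |lagP a k (nuR a k)| := by
  have hN := nuR_pos a k
  rw [← sq_le_sq]
  have hm : AntitoneOn (fun s => lagP a k s ^ 2) (Set.Ici (nuR a k)) := by
    refine antitoneOn_of_hasDerivWithinAt_nonpos (convex_Ici _)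
      (fun t _ => ((hasDerivAt_lagP a k t).pow 2).continuousAt.continuousWithinAt)
      (fun t _ => ((hasDerivAt_lagP a k t).pow 2).hasDerivWithinAt)
      (fun t ht => ?_)
    rw [interior_Ici, Set.mem_Ioi] at ht
    have h0 : 0 < t := by linarith
    have h1 : 0 ≤ t ^ a * ((t - nuR a k) / 2) := by
      have : 0 < t - nuR a k := by linarith
      positivity
    have := mul_nonpos_of_nonneg_of_nonpos h1 (lagP_mul_lagPhi_nonpos a k ht.le)
    simp only [Nat.add_one_sub_one, pow_one]
    push_cast
    linarith
  exact hm Set.self_mem_Ici hs hs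

/-- Beyond the turning point `lagG` is close to its limit. -/
lemma abs_lagG_sub_le (a k : ℕ) {s : ℝ} (hs : nuR a k < s) :
    |lagG a k s - (-1) ^ k * 2 ^ (a + 1) * lagR a k| ≤
      8 * |lagP a k (nuR a k)| / (s - nuR a k) := by
  set N := nuR a k with hN
  set P := |lagP a k N| with hP
  set L := (-1) ^ k * 2 ^ (a + 1) * lagR a k
  have hinv : Filter.Tendsto (fun t => 4 * (2 * P) / (t - N)) Filter.atTop (nhds 0) :=
    Filter.Tendsto.div_atTop tendsto_const_nhds
      (Filter.tendsto_atTop_add_const_right _ (-N) Filter.tendsto_id)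
  have hlim : ∀ σ : ℝ, |σ| ≤ 1 → Filter.Tendsto
      (fun t => lagG a k t - 4 * (lagP a k t + σ * P) / (t - N)) Filter.atTop (nhds L) := by
    intro σ hσ
    have h0 : Filter.Tendsto (fun t => 4 * (lagP a k t + σ * P) / (t - N))
        Filter.atTop (nhds 0) := by
      refine squeeze_zero_norm' ?_ hinv
      filter_upwards [Filter.eventually_gt_atTop N] with t ht
      have ht0 : 0 < t - N := by linarith
      rw [Real.norm_eq_abs, abs_div, abs_of_pos ht0, abs_mul, abs_of_pos (by norm_num : (0:ℝ) < 4)]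
      gcongr
      have h1 := abs_lagP_le a k ht.le
      have h2 : |σ * P| ≤ 1 * P := by
        rw [abs_mul, abs_of_nonneg (abs_nonneg _ : 0 ≤ P)]; gcongr
      have := abs_add_le (lagP a k t) (σ * P)
      linarith
    simpa using (tendsto_lagG a k).sub h0
  have hd : ∀ σ : ℝ, ∀ t ∈ Set.Ici s, HasDerivAt
      (fun t => lagG a k t - 4 * (lagP a k t + σ * P) / (t - N))
      (4 * (lagP a k t + σ * P) / (t - N) ^ 2) t := by
    intro σ t ht
    have hne : t - N ≠ 0 := by
      have : s ≤ t := ht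
      linarith
    refine ((hasDerivAt_lagG a k t).sub ((((hasDerivAt_lagP a k t).add_const (σ * P)).const_mul
      4).div ((hasDerivAt_id t).sub_const N) hne)).congr_deriv ?_
    simp only [id, ← hN]
    field_simp
    ring
  have hPs := abs_le.1 (abs_lagP_le a k hs.le)
  have hs0 : 0 < s - N := by linarith
  have hup : L ≤ lagG a k s - 4 * (lagP a k s + (-1) * P) / (s - N) := by
    refine le_of_tendsto (hlim (-1) (by simp)) ?_
    filter_upwards [Filter.eventually_ge_atTop s] with t ht
    refine antitoneOn_of_hasDerivWithinAt_nonpos (convex_Ici s)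
      (fun t ht => (hd (-1) t ht).continuousAt.continuousWithinAt)
      (fun t ht => (hd (-1) t (interior_subset ht)).hasDerivWithinAt) (fun t ht => ?_)
      Set.self_mem_Ici ht ht
    have ht' : s ≤ t := interior_subset ht
    have := (abs_le.1 (abs_lagP_le a k (hs.le.trans ht'))).2
    exact div_nonpos_of_nonpos_of_nonneg (by linarith) (sq_nonneg _)
  have hlo : lagG a k s - 4 * (lagP a k s + 1 * P) / (s - N) ≤ L := by
    refine ge_of_tendsto (hlim 1 (by simp)) ?_
    filter_upwards [Filter.eventually_ge_atTop s] with t ht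
    refine monotoneOn_of_hasDerivWithinAt_nonneg (convex_Ici s)
      (fun t ht => (hd 1 t ht).continuousAt.continuousWithinAt)
      (fun t ht => (hd 1 t (interior_subset ht)).hasDerivWithinAt) (fun t ht => ?_)
      Set.self_mem_Ici ht ht
    have ht' : s ≤ t := interior_subset ht
    have := (abs_le.1 (abs_lagP_le a k (hs.le.trans ht'))).1
    exact div_nonneg (by linarith) (sq_nonneg _)
  have b1 : 4 * (lagP a k s + 1 * P) / (s - N) ≤ 8 * P / (s - N) := by
    exact div_le_div_of_nonneg_right (by linarith [hPs.2]) hs0.le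
  have b2 : -(8 * P / (s - N)) ≤ 4 * (lagP a k s + (-1) * P) / (s - N) := by
    rw [← neg_div]; exact div_le_div_of_nonneg_right (by linarith [hPs.1]) hs0.le
  rw [abs_le]
  constructor <;> linarith

/-- The range beyond the turning point. -/
lemma exists_lagF_ge_of_add (a : ℕ) : ∃ K ≥ (1 : ℝ), ∃ c > 0, ∀ k : ℕ, ∀ δ Δ : ℝ, K ≤ δ →
    δ ^ 3 = nuR a k → K * δ ≤ Δ →
    c * lagPhi a k 0 ^ 2 * (Δ / Real.sqrt (nuR a k + Δ)) ≤
      lagF a k (Real.sqrt (nuR a k + Δ)) := by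
  obtain ⟨C, hC, hP⟩ := exists_lagP_nuR_sq_le a
  have ha : (0 : ℝ) ≤ a := Nat.cast_nonneg a
  refine ⟨2 * a + 8 + 16 * Real.sqrt C, by have := Real.sqrt_nonneg C; linarith, 3 / 64,
    by norm_num, fun k δ Δ hδ hN hΔ => ?_⟩
  have hC0 := Real.sqrt_nonneg C
  have hδ0 : 0 < δ := by linarith
  have hφ0 := lagPhi_zero_pos a k
  have hΔ8 : 8 * δ + 16 * Real.sqrt C * δ ≤ Δ := by
    have : 0 ≤ a * δ := by positivity
    linarith
  have hCδ : 0 ≤ Real.sqrt C * δ := by positivity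
  have hPN : |lagP a k (nuR a k)| ≤ Real.sqrt C * lagPhi a k 0 * δ := by
    refine abs_le_of_sq_le_sq ?_ (by positivity)
    rw [mul_pow, mul_pow, Real.sq_sqrt hC.le]
    exact hP k δ (by linarith) hN
  have hN0 := nuR_pos a k
  have hG : ∀ s, nuR a k + Δ / 2 ≤ s → lagPhi a k 0 ^ 2 ≤ lagG a k s ^ 2 := fun s hs => by
    have h1 := abs_lagG_sub_le a k (s := s) (by linarith)
    have h2 : 8 * |lagP a k (nuR a k)| / (s - nuR a k) ≤ lagPhi a k 0 := by
      rw [div_le_iff₀ (by linarith)]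
      have : lagPhi a k 0 * (8 * (Real.sqrt C * δ)) ≤ lagPhi a k 0 * (s - nuR a k) := by
        gcongr; linarith
      linarith
    have h3 : |(-1) ^ k * 2 ^ (a + 1) * lagR a k| = 2 ^ (a + 1) * lagR a k := by
      rw [abs_mul, abs_mul, abs_pow, abs_neg, abs_one, one_pow, one_mul, abs_of_pos (lagR_pos a k),
        abs_of_pos (by positivity)]
    have h4 : 2 * lagPhi a k 0 ≤ 2 ^ (a + 1) * lagR a k := by
      have : lagPhi a k 0 ≤ lagR a k := by
        rw [lagPhi_zero]
        exact div_le_self (lagR_pos a k).le (by exact_mod_cast a.factorial_pos)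
      have h5 : (2 : ℝ) ≤ 2 ^ (a + 1) := le_self_pow₀ (by norm_num) (by omega)
      gcongr
    rw [← sq_abs (lagG a k s)]
    gcongr
    have := abs_sub_abs_le_abs_sub ((-1) ^ k * 2 ^ (a + 1) * lagR a k) (lagG a k s)
    rw [abs_sub_comm] at this
    linarith
  obtain ⟨x₁, x₂, hx₁1, h12, hl1, hu1, hl2, hu2, hs1, hs2⟩ :=
    exists_window_sqrt (A := nuR a k + Δ / 2) (B := nuR a k + Δ) (by linarith [two_le_nuR a k])
      (by linarith)
  have hsin := integral_sin_sq_mul_ge (y := fun _ => lagPhi a k 0) (y' := fun _ => 0) (m := 0)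
    hx₁1 h12.le hs1 hs2 (fun t _ => hasDerivAt_const _ _) (fun x _ => by simp)
  simp only [intervalIntegral.integral_const, smul_eq_mul, mul_zero, zero_div, sub_zero] at hsin
  have hmono : ∫ x in x₁..x₂, Real.sin (2 * x ^ 2) ^ 2 * lagPhi a k 0 ^ 2 ≤
      ∫ x in x₁..x₂, Real.sin (2 * x ^ 2) ^ 2 * lagG a k (x ^ 2) ^ 2 := by
    refine intervalIntegral.integral_mono_on h12.le (by
      apply Continuous.intervalIntegrable; fun_prop)
      ((continuous_lagF_integrand a k).intervalIntegrable _ _) (fun x hx => ?_)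
    have : x₁ ^ 2 ≤ x ^ 2 := by have := hx.1; gcongr
    have := hG (x ^ 2) (by linarith)
    gcongr
  set X := Real.sqrt (nuR a k + Δ) with hX
  have hx₂X : x₂ ≤ X := Real.le_sqrt_of_sq_le hu2
  have hX0 : 0 < X := by linarith
  have hF := integral_le_lagF a k (by linarith : 0 ≤ x₁) h12.le hx₂X
  have hℓ : Δ / X ≤ 8 * (x₂ - x₁) := by
    rw [div_le_iff₀ hX0]
    have h1 : (x₂ - x₁) * (x₂ + x₁) = x₂ ^ 2 - x₁ ^ 2 := by ring
    have h2 : (x₂ - x₁) * (x₂ + x₁) ≤ (x₂ - x₁) * (2 * X) := by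
      have : 0 ≤ x₂ - x₁ := by linarith
      gcongr; linarith
    linarith
  have h6 : lagPhi a k 0 ^ 2 * (Δ / X) ≤ lagPhi a k 0 ^ 2 * (8 * (x₂ - x₁)) := by gcongr
  linarith

lemma exists_lagF_ge_of_le_div_sqrt (a : ℕ) {K : ℝ} (hK : 1 ≤ K) : ∃ c > (0 : ℝ), ∀ k : ℕ,
    ∀ X : ℝ, 0 < X → X ≤ K / Real.sqrt (nuR a k) →
    c * lagPhi a k 0 ^ 2 * X ^ (4 * a + 9) ≤ lagF a k X := by
  obtain ⟨c, hc, h⟩ := exists_lagF_ge_of_le_inv_sqrt a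
  have hK0 : 0 < K := by linarith
  refine ⟨c / K ^ (4 * a + 9), by positivity, fun k X hX hXK => ?_⟩
  have h1 : X / K ≤ 1 / Real.sqrt (nuR a k) := by
    rw [div_le_iff₀ hK0]; exact hXK.trans (le_of_eq (by ring))
  calc c / K ^ (4 * a + 9) * lagPhi a k 0 ^ 2 * X ^ (4 * a + 9) =
        c * lagPhi a k 0 ^ 2 * (X / K) ^ (4 * a + 9) := by rw [div_pow]; ring
    _ ≤ lagF a k (X / K) := h k _ (by positivity) h1
    _ ≤ lagF a k X := lagF_mono a k (by positivity) (div_le_self hX.le hK)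

lemma exists_lagF_ge_of_le_two (a : ℕ) : ∃ K ≥ (1 : ℝ), ∃ c > 0, ∀ k : ℕ, ∀ X : ℝ,
    2 * K ≤ Real.sqrt (nuR a k) → K / Real.sqrt (nuR a k) ≤ X → X ≤ 2 →
    c * lagPhi a k 0 ^ 2 * (X ^ (2 * a + 6) / Real.sqrt (nuR a k) ^ (2 * a + 3)) ≤
      lagF a k X := by
  obtain ⟨K, hK, c, hc, h⟩ := exists_lagF_ge_of_le_half a
  refine ⟨K, hK, c * (1 / 4) ^ (2 * a + 6), by positivity, fun k X hN hKX hX => ?_⟩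
  have hR : 0 < Real.sqrt (nuR a k) := Real.sqrt_pos.2 (nuR_pos a k)
  have hX0 : 0 < X := lt_of_lt_of_le (by positivity) hKX
  have hm : K / Real.sqrt (nuR a k) ≤ min X (1 / 2) := by
    refine le_min hKX ?_
    rw [div_le_iff₀ hR]; linarith
  have hm4 : 1 / 4 * X ≤ min X (1 / 2) := le_min (by linarith) (by linarith)
  calc c * (1 / 4) ^ (2 * a + 6) * lagPhi a k 0 ^ 2 *
        (X ^ (2 * a + 6) / Real.sqrt (nuR a k) ^ (2 * a + 3)) =
        c * lagPhi a k 0 ^ 2 *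
          ((1 / 4 * X) ^ (2 * a + 6) / Real.sqrt (nuR a k) ^ (2 * a + 3)) := by
        rw [mul_pow]; ring
    _ ≤ c * lagPhi a k 0 ^ 2 *
          (min X (1 / 2) ^ (2 * a + 6) / Real.sqrt (nuR a k) ^ (2 * a + 3)) := by gcongr
    _ ≤ lagF a k (min X (1 / 2)) := h k _ hm (min_le_right _ _)
    _ ≤ lagF a k X := lagF_mono a k (le_min hX0.le (by norm_num)) (min_le_left _ _)

lemma exists_lagF_ge_of_two_le (a : ℕ) : ∃ R₀ : ℝ, ∃ c > 0, ∀ k : ℕ, ∀ X : ℝ,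
    R₀ ≤ Real.sqrt (nuR a k) → 2 ≤ X → X ≤ Real.sqrt (nuR a k) →
    c * lagPhi a k 0 ^ 2 * (X ^ (2 * a + 2) / Real.sqrt (nuR a k) ^ (2 * a + 3)) ≤
      lagF a k X := by
  obtain ⟨ε, hε, c, hc, h⟩ := exists_lagF_ge_of_le_sqrt a
  refine ⟨2 / ε, c * min 1 ε ^ (2 * a + 2), by positivity, fun k X hN hX2 hX => ?_⟩
  rw [div_le_iff₀ hε] at hN
  have hR : 0 < Real.sqrt (nuR a k) := Real.sqrt_pos.2 (nuR_pos a k)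
  have hm : min 1 ε * X ≤ min X (ε * Real.sqrt (nuR a k)) := by
    refine le_min ?_ ?_
    · exact mul_le_of_le_one_left (by linarith) (min_le_left _ _)
    · gcongr; exact min_le_right _ _
  have h2 : 2 ≤ min X (ε * Real.sqrt (nuR a k)) := le_min hX2 (by linarith)
  have h0 : 0 ≤ min 1 ε * X := by positivity
  calc c * min 1 ε ^ (2 * a + 2) * lagPhi a k 0 ^ 2 *
        (X ^ (2 * a + 2) / Real.sqrt (nuR a k) ^ (2 * a + 3)) =
        c * lagPhi a k 0 ^ 2 *
          ((min 1 ε * X) ^ (2 * a + 2) / Real.sqrt (nuR a k) ^ (2 * a + 3)) := by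
        rw [mul_pow]; ring
    _ ≤ c * lagPhi a k 0 ^ 2 * (min X (ε * Real.sqrt (nuR a k)) ^ (2 * a + 2) /
          Real.sqrt (nuR a k) ^ (2 * a + 3)) := by gcongr
    _ ≤ lagF a k (min X (ε * Real.sqrt (nuR a k))) := h k _ h2 (min_le_right _ _)
    _ ≤ lagF a k X := lagF_mono a k (by linarith) (min_le_left _ _)

lemma exists_lagF_ge_low (a : ℕ) : ∃ R₀ : ℝ, ∃ c > 0, ∀ k : ℕ, ∀ X J : ℝ,
    R₀ ≤ Real.sqrt (nuR a k) → 0 < X → X ≤ Real.sqrt (nuR a k) → 0 ≤ J → J ≤ 1 →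
    J * (X * Real.sqrt (nuR a k)) ^ (2 * a + 3) ≤ 1 →
    J * ((X * Real.sqrt (nuR a k)) ^ (2 * a + 3) * X ^ 4) ≤ 1 →
    c * lagPhi a k 0 ^ 2 * (X ^ (4 * a + 9) * J) ≤ lagF a k X := by
  obtain ⟨K, hK, c₂, hc₂, h₂⟩ := exists_lagF_ge_of_le_two a
  obtain ⟨c₁, hc₁, h₁⟩ := exists_lagF_ge_of_le_div_sqrt a hK
  obtain ⟨R₀, c₃, hc₃, h₃⟩ := exists_lagF_ge_of_two_le a
  refine ⟨max (2 * K) R₀, min c₁ (min c₂ c₃), by positivity,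
    fun k X J hN hX hXN hJ₀ hJ₁ hJ₂ hJ₃ => ?_⟩
  have hR : 0 < Real.sqrt (nuR a k) := Real.sqrt_pos.2 (nuR_pos a k)
  set c := min c₁ (min c₂ c₃) with hc
  have hc0 : 0 < c := by positivity
  have hcc₁ : c ≤ c₁ := min_le_left _ _
  have hcc₂ : c ≤ c₂ := (min_le_right _ _).trans (min_le_left _ _)
  have hcc₃ : c ≤ c₃ := (min_le_right _ _).trans (min_le_right _ _)
  set R := Real.sqrt (nuR a k)
  rcases le_total X (K / R) with hXK | hXK
  · refine le_trans ?_ (h₁ k X hX hXK)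
    have : X ^ (4 * a + 9) * J ≤ X ^ (4 * a + 9) := mul_le_of_le_one_right (by positivity) hJ₁
    gcongr
  rcases le_total X 2 with hX2 | hX2
  · refine le_trans ?_ (h₂ k X ((le_max_left _ _).trans hN) hXK hX2)
    have : X ^ (4 * a + 9) * J ≤ X ^ (2 * a + 6) / R ^ (2 * a + 3) := by
      rw [le_div_iff₀ (by positivity)]
      calc X ^ (4 * a + 9) * J * R ^ (2 * a + 3) =
            X ^ (2 * a + 6) * (J * (X * R) ^ (2 * a + 3)) := by rw [mul_pow]; ring
        _ ≤ X ^ (2 * a + 6) * 1 := by gcongr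
        _ = _ := mul_one _
    gcongr
  · refine le_trans ?_ (h₃ k X ((le_max_right _ _).trans hN) hX2 hXN)
    have : X ^ (4 * a + 9) * J ≤ X ^ (2 * a + 2) / R ^ (2 * a + 3) := by
      rw [le_div_iff₀ (by positivity)]
      calc X ^ (4 * a + 9) * J * R ^ (2 * a + 3) =
            X ^ (2 * a + 2) * (J * ((X * R) ^ (2 * a + 3) * X ^ 4)) := by rw [mul_pow]; ring
        _ ≤ X ^ (2 * a + 2) * 1 := by gcongr
        _ = _ := mul_one _
    gcongr

lemma exists_lagF_ge_mid (a : ℕ) : ∃ δ₀ : ℝ, ∃ c > 0, ∀ k : ℕ, ∀ δ D J : ℝ,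
    δ₀ ≤ δ → δ ^ 3 = nuR a k → D ≤ nuR a k / 2 → 0 ≤ J → J ≤ 1 →
    (0 < D → J * Real.sqrt D ≤ Real.sqrt δ) →
    c * lagPhi a k 0 ^ 2 * (J / Real.sqrt δ) ≤ lagF a k (Real.sqrt (nuR a k - D)) := by
  obtain ⟨ε, hε, K, hK, c₁, hc₁, h₁⟩ := exists_lagF_ge_of_sub a
  obtain ⟨R₀, c₂, hc₂, h₂⟩ := exists_lagF_ge_of_two_le a
  have hK0 : 0 < K := by linarith
  set c := min (c₁ / Real.sqrt K) (min c₁ (c₂ * (1 / 2) ^ (a + 1) * Real.sqrt ε)) with hc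
  have hc0 : 0 < c := by positivity
  have hcc₁ : c ≤ c₁ / Real.sqrt K := min_le_left _ _
  have hcc₂ : c ≤ c₁ := (min_le_right _ _).trans (min_le_left _ _)
  have hcc₃ : c ≤ c₂ * (1 / 2) ^ (a + 1) * Real.sqrt ε := (min_le_right _ _).trans (min_le_right _ _)
  refine ⟨3 + R₀ ^ 2 + K / ε, c, hc0, fun k δ D J hδ hN hD hJ₀ hJ hJD => ?_⟩
  have hKε : 0 < K / ε := by positivity
  have hδ3 : 3 ≤ δ := by linarith [sq_nonneg R₀]
  have hδ0 : 0 < δ := by linarith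
  have hδ2 : δ ≤ δ ^ 2 := le_self_pow₀ (by linarith) (by norm_num)
  have hδN : δ ^ 2 ≤ nuR a k := by
    rw [← hN]; exact pow_le_pow_right₀ (by linarith) (by norm_num)
  have hN9 : 9 ≤ nuR a k := by nlinarith
  have hφ0 := lagPhi_zero_pos a k
  have hR : 0 < Real.sqrt (nuR a k) := Real.sqrt_pos.2 (by linarith)
  have hRR : Real.sqrt (nuR a k) ^ 2 = nuR a k := Real.sq_sqrt (by linarith)
  have hsδ : 0 < Real.sqrt δ := Real.sqrt_pos.2 hδ0
  have hεN : K * δ ≤ ε * nuR a k := by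
    have : K ≤ δ * ε := by rw [← div_le_iff₀ hε]; linarith [sq_nonneg R₀]
    calc K * δ ≤ δ * ε * δ := by gcongr
      _ = ε * δ ^ 2 := by ring
      _ ≤ _ := by gcongr
  have hsub : ∀ D, K * δ ≤ D → D ≤ ε * nuR a k →
      c₁ * lagPhi a k 0 ^ 2 / Real.sqrt D ≤ lagF a k (Real.sqrt (nuR a k - D)) := fun D h h' => by
    refine h₁ k D ?_ ?_ h'
    · exact le_trans (le_mul_of_one_le_right hK0.le (by linarith)) h
    · calc K * nuR a k ≤ K ^ 3 * nuR a k := by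
            gcongr
            exact le_self_pow₀ hK (by norm_num)
        _ = (K * δ) ^ 3 := by rw [← hN]; ring
        _ ≤ D ^ 3 := by gcongr
  rcases le_total D (K * δ) with hDK | hDK
  · refine le_trans ?_ ((hsub (K * δ) le_rfl hεN).trans
      (lagF_mono a k (Real.sqrt_nonneg _) (Real.sqrt_le_sqrt (by linarith))))
    rw [Real.sqrt_mul hK0.le]
    calc c * lagPhi a k 0 ^ 2 * (J / Real.sqrt δ) ≤
          c₁ / Real.sqrt K * lagPhi a k 0 ^ 2 * (1 / Real.sqrt δ) := by gcongr
      _ = _ := by field_simp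
  have hD0 : 0 < D := lt_of_lt_of_le (by positivity) hDK
  have hsD : 0 < Real.sqrt D := Real.sqrt_pos.2 hD0
  have hJD' : J / Real.sqrt δ ≤ 1 / Real.sqrt D := by
    rw [div_le_div_iff₀ hsδ hsD, one_mul]; exact hJD hD0
  rcases le_total D (ε * nuR a k) with hDε | hDε
  · refine le_trans ?_ (hsub D hDK hDε)
    calc c * lagPhi a k 0 ^ 2 * (J / Real.sqrt δ) ≤
          c₁ * lagPhi a k 0 ^ 2 * (1 / Real.sqrt D) := by gcongr
      _ = _ := by ring
  · have hX2 : Real.sqrt (nuR a k - D) ^ 2 = nuR a k - D := Real.sq_sqrt (by linarith)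
    refine le_trans ?_ (h₂ k (Real.sqrt (nuR a k - D)) ?_ ?_ (Real.sqrt_le_sqrt (by linarith)))
    · have hXR : (1 / 2) ^ (a + 1) * (1 / Real.sqrt (nuR a k)) ≤
          Real.sqrt (nuR a k - D) ^ (2 * a + 2) / Real.sqrt (nuR a k) ^ (2 * a + 3) := by
        have h5 : 1 / 2 * Real.sqrt (nuR a k) ^ 2 ≤ Real.sqrt (nuR a k - D) ^ 2 := by
          rw [hRR, hX2]; linarith
        rw [le_div_iff₀ (by positivity)]
        calc (1 / 2 : ℝ) ^ (a + 1) * (1 / Real.sqrt (nuR a k)) * Real.sqrt (nuR a k) ^ (2 * a + 3) =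
              (1 / 2 * Real.sqrt (nuR a k) ^ 2) ^ (a + 1) := by
              rw [mul_pow]; field_simp; ring
          _ ≤ (Real.sqrt (nuR a k - D) ^ 2) ^ (a + 1) := by gcongr
          _ = _ := by ring
      have hJε : J / Real.sqrt δ ≤ 1 / (Real.sqrt ε * Real.sqrt (nuR a k)) := by
        rw [← Real.sqrt_mul hε.le]
        refine hJD'.trans ?_
        gcongr
      calc c * lagPhi a k 0 ^ 2 * (J / Real.sqrt δ) ≤ c₂ * (1 / 2) ^ (a + 1) * Real.sqrt ε *
            lagPhi a k 0 ^ 2 * (1 / (Real.sqrt ε * Real.sqrt (nuR a k))) := by gcongr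
        _ = c₂ * lagPhi a k 0 ^ 2 * ((1 / 2) ^ (a + 1) * (1 / Real.sqrt (nuR a k))) := by
            have := Real.sqrt_pos.2 hε
            field_simp
        _ ≤ _ := by gcongr
    · refine Real.le_sqrt_of_sq_le ?_
      have : R₀ ^ 2 ≤ δ := by linarith
      linarith
    · refine Real.le_sqrt_of_sq_le ?_
      linarith

lemma exists_lagF_ge_high (a : ℕ) : ∃ δ₀ : ℝ, ∃ c > 0, ∀ k : ℕ, ∀ δ Δ : ℝ,
    δ₀ ≤ δ → δ ^ 3 = nuR a k → 0 ≤ Δ →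
    c * lagPhi a k 0 ^ 2 * (Δ / Real.sqrt (nuR a k + Δ)) ≤
      lagF a k (Real.sqrt (nuR a k + Δ)) := by
  obtain ⟨δ₁, c₁, hc₁, h₁⟩ := exists_lagF_ge_mid a
  obtain ⟨K, hK, c₂, hc₂, h₂⟩ := exists_lagF_ge_of_add a
  have hK0 : 0 < K := by linarith
  refine ⟨max δ₁ K, min (c₁ / K) c₂, by positivity, fun k δ Δ hδ hN hΔ => ?_⟩
  have hδK : K ≤ δ := (le_max_right _ _).trans hδ
  have hN0 := nuR_pos a k
  have hφ0 := lagPhi_zero_pos a k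
  have hX : 0 < Real.sqrt (nuR a k + Δ) := Real.sqrt_pos.2 (by linarith)
  rcases le_total (K * δ) Δ with h | h
  · refine le_trans ?_ (h₂ k δ Δ hδK hN h)
    gcongr
    exact min_le_right _ _
  · have hδ0 : 0 < δ := by linarith
    have hsδ : 0 < Real.sqrt δ := Real.sqrt_pos.2 hδ0
    have hF := h₁ k δ 0 1 ((le_max_left _ _).trans hδ) hN (by linarith) zero_le_one le_rfl
      (fun h => absurd h (lt_irrefl 0))
    refine le_trans ?_ (hF.trans (lagF_mono a k (Real.sqrt_nonneg _)
      (Real.sqrt_le_sqrt (by linarith))))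
    have hR : Real.sqrt (nuR a k) = δ * Real.sqrt δ := by
      rw [← hN, show δ ^ 3 = δ ^ 2 * δ by ring, Real.sqrt_mul (by positivity),
        Real.sqrt_sq hδ0.le]
    have hle : Δ / Real.sqrt (nuR a k + Δ) ≤ K * (1 / Real.sqrt δ) := by
      calc Δ / Real.sqrt (nuR a k + Δ) ≤ K * δ / Real.sqrt (nuR a k) := by
            gcongr; linarith
        _ = _ := by rw [hR]; field_simp
    calc min (c₁ / K) c₂ * lagPhi a k 0 ^ 2 * (Δ / Real.sqrt (nuR a k + Δ)) ≤
          c₁ / K * lagPhi a k 0 ^ 2 * (K * (1 / Real.sqrt δ)) := by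
          gcongr; exact min_le_left _ _
      _ = _ := by field_simp

lemma one_le_jap (x : ℝ) : 1 ≤ jap x := by
  rw [jap, Real.one_le_sqrt]; linarith [sq_nonneg x]

lemma le_jap (x : ℝ) : x ≤ jap x := Real.le_sqrt_of_sq_le (by linarith)

lemma jap_pos (x : ℝ) : 0 < jap x := zero_lt_one.trans_le (one_le_jap x)

lemma jap_rpow_neg_half (x : ℝ) (m : ℕ) :
    jap x ^ (-(m : ℝ) / 2) = (Real.sqrt (jap x) ^ m)⁻¹ := by
  rw [Real.sqrt_eq_rpow, ← Real.rpow_mul_natCast (jap_pos x).le, ← Real.rpow_neg (jap_pos x).le]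
  congr 1
  ring

lemma jap_rpow_neg_two (x : ℝ) : jap x ^ (-(2 : ℝ)) = (1 + x ^ 2)⁻¹ := by
  rw [Real.rpow_neg (jap_pos x).le, Real.rpow_two, jap, Real.sq_sqrt (by positivity)]

lemma exists_avgSq_ge (a : ℕ) : ∃ c > (0 : ℝ), ∀ k : ℕ, ∀ lam M : ℝ, 0 < lam →
    M * lagPhi a k 0 ^ 2 ≤ lagF a k (Real.sqrt (lam / 2)) →
    c * (M * (lam ^ (2 * a + 4))⁻¹ * (Real.sqrt (lam / 2))⁻¹) ≤ avgSq (a + 1) k lam := by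
  refine ⟨2 ^ (a + 2) / (a.factorial : ℝ) ^ 2, by positivity, fun k lam M hlam h => ?_⟩
  have hR := lagR_pos a k
  rw [avgSq_eq a k hlam]
  rw [lagPhi_zero] at h
  have hX : 0 < Real.sqrt (lam / 2) := Real.sqrt_pos.2 (by positivity)
  calc 2 ^ (a + 2) / (a.factorial : ℝ) ^ 2 *
        (M * (lam ^ (2 * a + 4))⁻¹ * (Real.sqrt (lam / 2))⁻¹) =
        2 ^ (a + 2) * (lagR a k ^ 2)⁻¹ * (lam ^ (2 * a + 4))⁻¹ * (Real.sqrt (lam / 2))⁻¹ *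
          (M * (lagR a k / a.factorial) ^ 2) := by field_simp
    _ ≤ _ := by gcongr

lemma exists_avgSq_ge_low (a : ℕ) : ∃ R₀ : ℝ, ∃ c > 0, ∀ k : ℕ, ∀ lam : ℝ,
    R₀ ≤ Real.sqrt (nuR a k) → 0 < lam → lam ≤ nuR a k →
    c * (jap (lam * nuR a k) ^ (-((2 * a + 3 : ℕ) : ℝ) / 2) * jap lam ^ (-(2 : ℝ))) ≤
      avgSq (a + 1) k lam := by
  obtain ⟨R₀, c₁, hc₁, h₁⟩ := exists_lagF_ge_low a
  obtain ⟨c₂, hc₂, h₂⟩ := exists_avgSq_ge a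
  refine ⟨R₀, c₂ * c₁ * (1 / 2) ^ (2 * a + 4), by positivity, fun k lam hN hlam hlamN => ?_⟩
  rw [jap_rpow_neg_half, jap_rpow_neg_two]
  have hN0 := nuR_pos a k
  have hX : 0 < Real.sqrt (lam / 2) := Real.sqrt_pos.2 (by positivity)
  have hX2 : Real.sqrt (lam / 2) ^ 2 = lam / 2 := Real.sq_sqrt (by positivity)
  have hA := one_le_jap (lam * nuR a k)
  have ht : 1 ≤ Real.sqrt (jap (lam * nuR a k)) := Real.one_le_sqrt.2 hA
  have htX : Real.sqrt (lam / 2) * Real.sqrt (nuR a k) ≤ Real.sqrt (jap (lam * nuR a k)) := by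
    rw [← Real.sqrt_mul (by positivity)]
    refine Real.sqrt_le_sqrt (le_trans ?_ (le_jap _))
    gcongr; linarith
  have h4 : Real.sqrt (lam / 2) ^ 4 ≤ 1 + lam ^ 2 := by
    rw [show Real.sqrt (lam / 2) ^ 4 = (Real.sqrt (lam / 2) ^ 2) ^ 2 by ring, hX2]
    linarith [sq_nonneg lam]
  have hF := h₁ k (Real.sqrt (lam / 2))
    ((Real.sqrt (jap (lam * nuR a k)) ^ (2 * a + 3))⁻¹ * (1 + lam ^ 2)⁻¹) hN hX
    (Real.sqrt_le_sqrt (by linarith)) (by positivity)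
  set X := Real.sqrt (lam / 2)
  set t := Real.sqrt (jap (lam * nuR a k))
  have ht0 : 0 < t := by linarith
  have htm : 1 ≤ t ^ (2 * a + 3) := one_le_pow₀ ht
  have hl1 : 1 ≤ 1 + lam ^ 2 := by linarith [sq_nonneg lam]
  have hinv : (1 + lam ^ 2)⁻¹ ≤ 1 := inv_le_one_of_one_le₀ hl1
  replace hF := hF (mul_le_one₀ (inv_le_one_of_one_le₀ htm) (by positivity) hinv) (by
      calc (t ^ (2 * a + 3))⁻¹ * (1 + lam ^ 2)⁻¹ * (X * Real.sqrt (nuR a k)) ^ (2 * a + 3) ≤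
            (t ^ (2 * a + 3))⁻¹ * 1 * t ^ (2 * a + 3) := by gcongr
        _ = 1 := by field_simp) (by
      calc (t ^ (2 * a + 3))⁻¹ * (1 + lam ^ 2)⁻¹ *
            ((X * Real.sqrt (nuR a k)) ^ (2 * a + 3) * X ^ 4) ≤
            (t ^ (2 * a + 3))⁻¹ * (1 + lam ^ 2)⁻¹ * (t ^ (2 * a + 3) * (1 + lam ^ 2)) := by gcongr
        _ = 1 := by field_simp)
  refine le_trans (le_of_eq ?_) (h₂ k lam (c₁ * (X ^ (4 * a + 9) *
    ((t ^ (2 * a + 3))⁻¹ * (1 + lam ^ 2)⁻¹))) hlam (le_trans (le_of_eq (by ring)) hF))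
  have e : X ^ (4 * a + 9) * (lam ^ (2 * a + 4))⁻¹ * X⁻¹ = (1 / 2) ^ (2 * a + 4) := by
    rw [show lam = 2 * X ^ 2 by linarith, mul_pow, one_div, inv_pow]
    field_simp
    ring
  rw [← e]
  ring

lemma exists_avgSq_ge_mid (a : ℕ) : ∃ δ₀ : ℝ, ∃ c > 0, ∀ k : ℕ, ∀ δ lam : ℝ,
    δ₀ ≤ δ → δ ^ 3 = nuR a k → nuR a k < lam → lam ≤ 2 * (nuR a k + δ) →
    c * ((lam ^ (2 * a + 4))⁻¹ * lam ^ (-(2 / 3) : ℝ) *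
      jap (δ ^ 2 * (1 - lam / (2 * nuR a k))) ^ (-((1 : ℕ) : ℝ) / 2)) ≤ avgSq (a + 1) k lam := by
  obtain ⟨δ₀, c₁, hc₁, h₁⟩ := exists_lagF_ge_mid a
  obtain ⟨c₂, hc₂, h₂⟩ := exists_avgSq_ge a
  refine ⟨max 1 δ₀, c₂ * c₁ / 2, by positivity, fun k δ lam hδ hN hl hu => ?_⟩
  have hδ1 : 1 ≤ δ := (le_max_left _ _).trans hδ
  have hδ0 : 0 < δ := by linarith
  have hN0 := nuR_pos a k
  have hlam : 0 < lam := by linarith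
  have hsδ : 0 < Real.sqrt δ := Real.sqrt_pos.2 hδ0
  have hsδ2 : Real.sqrt δ ^ 2 = δ := Real.sq_sqrt hδ0.le
  have hX : 0 < Real.sqrt (lam / 2) := Real.sqrt_pos.2 (by positivity)
  rw [jap_rpow_neg_half, pow_one]
  set u := δ ^ 2 * (1 - lam / (2 * nuR a k)) with hu'
  have ht : 1 ≤ Real.sqrt (jap u) := Real.one_le_sqrt.2 (one_le_jap u)
  have hD : nuR a k - lam / 2 = δ * u := by
    rw [hu', ← hN]; field_simp
  have hF := h₁ k δ (nuR a k - lam / 2) (Real.sqrt (jap u))⁻¹ ((le_max_right _ _).trans hδ) hN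
    (by linarith) (by positivity) (inv_le_one_of_one_le₀ ht) (fun h => by
      rw [inv_mul_le_iff₀ (by linarith), ← Real.sqrt_mul (jap_pos u).le, hD, mul_comm]
      refine Real.sqrt_le_sqrt ?_
      gcongr
      exact le_jap u)
  rw [sub_sub_cancel] at hF
  refine le_trans ?_ (h₂ k lam (c₁ * ((Real.sqrt (jap u))⁻¹ / Real.sqrt δ)) hlam
    (le_trans (le_of_eq (by ring)) hF))
  have hpow : lam ^ (-(2 / 3) : ℝ) ≤ (δ ^ 2)⁻¹ := by
    calc lam ^ (-(2 / 3) : ℝ) ≤ (δ ^ 3) ^ (-(2 / 3) : ℝ) :=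
          Real.rpow_le_rpow_of_nonpos (by positivity) (by linarith) (by norm_num)
      _ = (δ ^ 2)⁻¹ := by
          rw [← Real.rpow_natCast δ 3, ← Real.rpow_mul hδ0.le, ← Real.rpow_natCast δ 2,
            ← Real.rpow_neg hδ0.le]
          norm_num
  have hXu : Real.sqrt (lam / 2) ≤ 2 * (δ * Real.sqrt δ) := by
    refine Real.sqrt_le_left (by positivity) |>.2 ?_
    rw [mul_pow, mul_pow, hsδ2]
    have : δ ≤ δ ^ 3 := le_self_pow₀ hδ1 (by norm_num)
    have e : δ ^ 2 * δ = δ ^ 3 := by ring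
    linarith
  have hfin : lam ^ (-(2 / 3) : ℝ) ≤ 2 * ((Real.sqrt δ)⁻¹ * (Real.sqrt (lam / 2))⁻¹) := by
    refine hpow.trans ?_
    rw [← mul_inv, ← div_eq_mul_inv, le_div_iff₀ (by positivity), inv_mul_le_iff₀ (by positivity)]
    calc Real.sqrt δ * Real.sqrt (lam / 2) ≤ Real.sqrt δ * (2 * (δ * Real.sqrt δ)) := by gcongr
      _ = 2 * δ * Real.sqrt δ ^ 2 := by ring
      _ = δ ^ 2 * 2 := by rw [hsδ2]; ring
  calc c₂ * c₁ / 2 * ((lam ^ (2 * a + 4))⁻¹ * lam ^ (-(2 / 3) : ℝ) * (Real.sqrt (jap u))⁻¹) ≤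
        c₂ * c₁ / 2 * ((lam ^ (2 * a + 4))⁻¹ *
          (2 * ((Real.sqrt δ)⁻¹ * (Real.sqrt (lam / 2))⁻¹)) * (Real.sqrt (jap u))⁻¹) := by gcongr
    _ = _ := by ring

lemma exists_avgSq_ge_high (a : ℕ) : ∃ δ₀ : ℝ, ∃ c > 0, ∀ k : ℕ, ∀ δ lam : ℝ,
    δ₀ ≤ δ → δ ^ 3 = nuR a k → 2 * nuR a k ≤ lam →
    c * ((lam ^ (2 * a + 4))⁻¹ * lam⁻¹ * (lam - 2 * nuR a k)) ≤ avgSq (a + 1) k lam := by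
  obtain ⟨δ₀, c₁, hc₁, h₁⟩ := exists_lagF_ge_high a
  obtain ⟨c₂, hc₂, h₂⟩ := exists_avgSq_ge a
  refine ⟨δ₀, c₂ * c₁, by positivity, fun k δ lam hδ hN hl => ?_⟩
  have hN0 := nuR_pos a k
  have hlam : 0 < lam := by linarith
  have hX : 0 < Real.sqrt (lam / 2) := Real.sqrt_pos.2 (by positivity)
  have hX2 : Real.sqrt (lam / 2) ^ 2 = lam / 2 := Real.sq_sqrt (by positivity)
  have hF := h₁ k δ (lam / 2 - nuR a k) hδ hN (by linarith)
  rw [add_sub_cancel] at hF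
  refine le_trans (le_of_eq ?_) (h₂ k lam (c₁ * ((lam / 2 - nuR a k) / Real.sqrt (lam / 2))) hlam
    (le_trans (le_of_eq (by ring)) hF))
  set X := Real.sqrt (lam / 2)
  rw [show lam = 2 * X ^ 2 by linarith]
  field_simp

/-- Lower bounds for `∫₀¹ |χ̂_{B_ρ}(λ,k)|² dρ` (with `Q = 2n+2`,
`ν = 4k+2n` large enough): it is `≳ ⟨λν⟩^{−Q/2+1/2}⟨λ⟩^{−2}` for `0 < λ ≤ ν`,
`≳ λ^{−Q−2/3}⟨ν^{2/3}(1−λ/(2ν))⟩^{−1/2}` for `ν < λ ≤ 2(ν+ν^{1/3})`, and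
`≳ λ^{−Q−1}(λ−2ν)` for `λ > 2(ν+ν^{1/3})`. -/
theorem avgSq_lower_bounds (n : ℕ) (hn : 1 ≤ n) :
    ∃ ν₀ : ℕ, ∃ c > (0 : ℝ), ∀ k : ℕ, ν₀ ≤ nuv n k → ∀ lam : ℝ, 0 < lam →
      ((lam ≤ (nuv n k : ℝ) →
          c * (jap (lam * (nuv n k : ℝ)) ^ (-(2 * (n : ℝ) + 2) / 2 + 1 / 2) *
              jap lam ^ (-(2 : ℝ))) ≤ avgSq n k lam) ∧
        ((nuv n k : ℝ) < lam →
          lam ≤ 2 * ((nuv n k : ℝ) + (nuv n k : ℝ) ^ ((1 : ℝ) / 3)) →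
          c * (lam ^ (-(2 * (n : ℝ) + 2) - 2 / 3) *
              jap ((nuv n k : ℝ) ^ ((2 : ℝ) / 3) *
                (1 - lam / (2 * (nuv n k : ℝ)))) ^ (-(1 : ℝ) / 2)) ≤ avgSq n k lam) ∧
        (2 * ((nuv n k : ℝ) + (nuv n k : ℝ) ^ ((1 : ℝ) / 3)) < lam →
          c * (lam ^ (-(2 * (n : ℝ) + 2) - 1) * (lam - 2 * (nuv n k : ℝ))) ≤
            avgSq n k lam)) := by
  obtain ⟨a, rfl⟩ : ∃ a, n = a + 1 := ⟨n - 1, by omega⟩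
  obtain ⟨R₀, c₁, hc₁, h₁⟩ := exists_avgSq_ge_low a
  obtain ⟨δ₁, c₂, hc₂, h₂⟩ := exists_avgSq_ge_mid a
  obtain ⟨δ₂, c₃, hc₃, h₃⟩ := exists_avgSq_ge_high a
  set c := min c₁ (min c₂ c₃)
  have hc0 : 0 < c := by positivity
  have hcc₁ : c ≤ c₁ := min_le_left _ _
  have hcc₂ : c ≤ c₂ := (min_le_right _ _).trans (min_le_left _ _)
  have hcc₃ : c ≤ c₃ := (min_le_right _ _).trans (min_le_right _ _)
  refine ⟨⌈R₀ ^ 2 + |δ₁| ^ 3 + |δ₂| ^ 3⌉₊, c, hc0, fun k hν lam hlam => ?_⟩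
  replace hν := Nat.ceil_le.1 hν
  rw [nuR_eq] at hν ⊢
  have hN0 := nuR_pos a k
  set δ := nuR a k ^ ((1 : ℝ) / 3) with hδ
  have hδ0 : 0 < δ := by positivity
  have hN : δ ^ 3 = nuR a k := by
    rw [hδ, ← Real.rpow_mul_natCast hN0.le]; norm_num
  have hδsq : nuR a k ^ ((2 : ℝ) / 3) = δ ^ 2 := by
    rw [hδ, ← Real.rpow_mul_natCast hN0.le]; norm_num
  have hle : ∀ x : ℝ, |x| ^ 3 ≤ nuR a k → x ≤ δ := fun x hx =>
    (le_abs_self x).trans ((pow_le_pow_iff_left₀ (abs_nonneg x) hδ0.le three_ne_zero).1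
      (hN ▸ hx))
  have p0 := sq_nonneg R₀
  have p1 : 0 ≤ |δ₁| ^ 3 := by positivity
  have p2 : 0 ≤ |δ₂| ^ 3 := by positivity
  have hR₀ : R₀ ≤ Real.sqrt (nuR a k) := Real.le_sqrt_of_sq_le (by linarith)
  have hδ₁ : δ₁ ≤ δ := hle δ₁ (by linarith)
  have hδ₂ : δ₂ ≤ δ := hle δ₂ (by linarith)
  have hrpow : ∀ x : ℝ, lam ^ (-(2 * ((a + 1 : ℕ) : ℝ) + 2) - x) =
      (lam ^ (2 * a + 4))⁻¹ * lam ^ (-x) := fun x => by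
    rw [sub_eq_add_neg, Real.rpow_add hlam, Real.rpow_neg hlam.le, ← Real.rpow_natCast lam]
    congr 3
    push_cast
    ring
  refine ⟨fun h => ?_, fun hl hu => ?_, fun hl => ?_⟩
  · refine le_trans ?_ (h₁ k lam hR₀ hlam h)
    rw [show -(2 * ((a + 1 : ℕ) : ℝ) + 2) / 2 + 1 / 2 = -((2 * a + 3 : ℕ) : ℝ) / 2 by
      push_cast; ring]
    have := jap_pos (lam * nuR a k)
    have := jap_pos lam
    gcongr
  · refine le_trans ?_ (h₂ k δ lam hδ₁ hN hl hu)
    rw [hrpow, hδsq, Nat.cast_one]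
    have := jap_pos (δ ^ 2 * (1 - lam / (2 * nuR a k)))
    gcongr
  · refine le_trans ?_ (h₃ k δ lam hδ₂ hN (by linarith))
    rw [hrpow, Real.rpow_neg_one]
    have : 0 ≤ lam - 2 * nuR a k := by linarith
    gcongr

end
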